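/- arXiv:2404.09548 — 4 statements merged into one kernel-verified Lean document; each statement's English description precedes it below -/
import Mathlib

section
/- Let n ≥ 2 and let R = ℂ[x_1,…,x_{n−1}, y_1,…,y_{n−1}, z_1,…,z_{n−1}] be the polynomial ring over ℂ in 3(n−1) variables. With the convention z_0 = z_n = 0, set L_i = 2z_i − z_{i−1} − z_{i+1} for i = 1,…,n−1. Then the ideal I^{(2)} of R generated by the 2(n−1) polynomials L_i·x_i and L_i·y_i (i = 1,…,n−1) is a radical ideal. -/
open MvPolynomial

noncomputable section

/-- Variables of `R = ℂ[x_1,…,x_{n−1}, y_1,…,y_{n−1}, z_1,…,z_{n−1}]`. -/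
abbrev PVars (n : ℕ) := Fin (n - 1) ⊕ Fin (n - 1) ⊕ Fin (n - 1)

/-- The variable `x_{i+1}` for `i : Fin (n-1)`. -/
def xVar (n : ℕ) (i : Fin (n - 1)) : MvPolynomial (PVars n) ℂ := X (Sum.inl i)

/-- The variable `y_{i+1}` for `i : Fin (n-1)`. -/
def yVar (n : ℕ) (i : Fin (n - 1)) : MvPolynomial (PVars n) ℂ := X (Sum.inr (Sum.inl i))

/-- `z_k` for `k : ℕ`, with the convention `z_0 = z_n = 0` (indeed `z_k = 0` unless
`1 ≤ k ≤ n − 1`). -/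
def zVar (n : ℕ) (k : ℕ) : MvPolynomial (PVars n) ℂ :=
  if h : 1 ≤ k ∧ k ≤ n - 1 then X (Sum.inr (Sum.inr ⟨k - 1, by omega⟩)) else 0

/-- `L_i = 2 z_i − z_{i−1} − z_{i+1}` for `1 ≤ i ≤ n − 1` (with `z_0 = z_n = 0`). -/
def LPoly (n : ℕ) (i : ℕ) : MvPolynomial (PVars n) ℂ :=
  2 * zVar n i - zVar n (i - 1) - zVar n (i + 1)

namespace MvPolynomial

/-- An ideal generated by variables is prime. -/
theorem isPrime_span_X_image {σ R : Type*} [CommRing R] [IsDomain R] (s : Set σ) :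
    (Ideal.span (X '' s : Set (MvPolynomial σ R))).IsPrime := by
  classical
  let φ : MvPolynomial σ R →ₐ[R] MvPolynomial σ R := aeval fun i => if i ∈ s then 0 else X i
  have hker : Ideal.span (X '' s : Set (MvPolynomial σ R)) = RingHom.ker φ := by
    refine le_antisymm ?_ fun p hp => ?_
    · rw [Ideal.span_le]
      rintro _ ⟨i, hi, rfl⟩
      simp [φ, hi]
    · have hcomp : (Ideal.Quotient.mkₐ R (Ideal.span (X '' s : Set (MvPolynomial σ R)))).comp φ =
          Ideal.Quotient.mkₐ R _ := by
        ext i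
        by_cases hi : i ∈ s
        · have : Ideal.Quotient.mk (Ideal.span (X '' s : Set (MvPolynomial σ R))) (X i) = 0 :=
            Ideal.Quotient.eq_zero_iff_mem.mpr (Ideal.subset_span ⟨i, hi, rfl⟩)
          simp [φ, hi, this]
        · simp [φ, hi]
      have h := DFunLike.congr_fun hcomp p
      rw [AlgHom.comp_apply, (RingHom.mem_ker).mp hp, map_zero] at h
      exact Ideal.Quotient.eq_zero_iff_mem.mp h.symm
  rw [hker]
  exact RingHom.ker_isPrime _

/-- Ideals generated by squarefree monomials are radical. -/
theorem isRadical_span_monomial_image {σ R : Type*} [CommRing R] [IsDomain R]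
    (s : Set (σ →₀ ℕ)) (hs : ∀ a ∈ s, ∀ i, a i ≤ 1) :
    (Ideal.span ((fun a => monomial a (1 : R)) '' s)).IsRadical := by
  rintro p ⟨k, hk⟩
  rw [mem_ideal_span_monomial_image]
  intro m hm
  by_contra! hcon
  have hle : Ideal.span ((fun a => monomial a (1 : R)) '' s) ≤
      Ideal.span (X '' {i | m i = 0} : Set (MvPolynomial σ R)) := by
    rw [Ideal.span_le]
    rintro _ ⟨a, ha, rfl⟩
    obtain ⟨i, hi⟩ : ∃ i, m i < a i := by simpa [Finsupp.le_def] using hcon a ha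
    have := hs a ha i
    refine mem_ideal_span_X_image.mpr fun b hb => ⟨i, show m i = 0 by omega, ?_⟩
    rw [Finset.mem_singleton.mp (support_monomial_subset hb)]
    omega
  obtain ⟨i, hi, hi'⟩ := mem_ideal_span_X_image.mp
    ((isPrime_span_X_image {i | m i = 0}).mem_of_pow_mem k (hle hk)) m hm
  exact hi' hi

/-- The substitution fixing the variables indexed by `τ` and `κ` and replacing those indexed by `ι`
by the linear forms given by the rows of a matrix. -/
def linearSubst (τ κ : Type*) {ι R : Type*} [Fintype ι] [CommRing R]
    (M : Matrix ι ι R) : MvPolynomial (τ ⊕ κ ⊕ ι) R →ₐ[R] MvPolynomial (τ ⊕ κ ⊕ ι) R :=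
  aeval (Sum.elim (fun t => X (Sum.inl t)) (Sum.elim (fun t => X (Sum.inr (Sum.inl t)))
    fun i => ∑ j, C (M i j) * X (Sum.inr (Sum.inr j))))

section linearSubst

variable {τ κ ι R : Type*} [Fintype ι] [CommRing R]

@[simp]
theorem linearSubst_X_inl (M : Matrix ι ι R) (t : τ) :
    linearSubst τ κ M (X (Sum.inl t)) = X (Sum.inl t) := by
  simp [linearSubst]

@[simp]
theorem linearSubst_X_inr_inl (M : Matrix ι ι R) (t : κ) :
    linearSubst τ κ M (X (Sum.inr (Sum.inl t))) = X (Sum.inr (Sum.inl t)) := by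
  simp [linearSubst]

@[simp]
theorem linearSubst_X_inr_inr (M : Matrix ι ι R) (i : ι) :
    linearSubst τ κ M (X (Sum.inr (Sum.inr i))) = ∑ j, C (M i j) * X (Sum.inr (Sum.inr j)) := by
  simp [linearSubst]

theorem linearSubst_linearSubst_of_mul_eq_one [DecidableEq ι] {M N : Matrix ι ι R}
    (h : N * M = 1) (p : MvPolynomial (τ ⊕ κ ⊕ ι) R) :
    linearSubst τ κ M (linearSubst τ κ N p) = p := by
  suffices H : (linearSubst τ κ M).comp (linearSubst τ κ N) = AlgHom.id R _ from
    DFunLike.congr_fun H p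
  ext1 (t | t | i)
  · simp
  · simp
  · have h1 : ∀ k, ∑ j, N i j * M j k = if i = k then 1 else 0 := fun k => by
      rw [← Matrix.mul_apply, h, Matrix.one_apply]
    simp only [AlgHom.comp_apply, linearSubst_X_inr_inr, map_sum, map_mul, AlgHom.id_apply,
      algHom_C, Finset.mul_sum, algebraMap_eq]
    rw [Finset.sum_comm]
    simp_rw [← mul_assoc, ← Finset.sum_mul, ← C_mul, ← map_sum, h1]
    simp [apply_ite C, ite_mul]

/-- Invertible linear substitutions preserve radicality. -/
theorem isRadical_map_linearSubst [DecidableEq ι] {M : Matrix ι ι R} (hM : IsUnit M)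
    {I : Ideal (MvPolynomial (τ ⊕ κ ⊕ ι) R)} (hI : I.IsRadical) :
    (I.map (linearSubst τ κ M)).IsRadical := by
  obtain ⟨N, hMN, hNM⟩ := isUnit_iff_exists.mp hM
  rintro p ⟨k, hk⟩
  have hmap : (I.map (linearSubst τ κ M)).map (linearSubst τ κ N) ≤ I := by
    rw [Ideal.map_le_iff_le_comap, Ideal.map_le_iff_le_comap]
    intro q hq
    simpa [Ideal.mem_comap, linearSubst_linearSubst_of_mul_eq_one hMN] using hq
  have hp : linearSubst τ κ N p ∈ I :=
    hI ⟨k, by simpa using hmap (Ideal.mem_map_of_mem _ hk)⟩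
  simpa [linearSubst_linearSubst_of_mul_eq_one hNM] using
    Ideal.mem_map_of_mem (linearSubst τ κ M) hp

end linearSubst

end MvPolynomial

/-- The matrix of second differences with Dirichlet boundary conditions, that is, the Cartan matrix
of type `A`. -/
def secondDifference (m : ℕ) : Matrix (Fin m) (Fin m) ℂ := fun i j =>
  2 * (if (j : ℕ) = i then 1 else 0) - (if (j : ℕ) + 1 = i then 1 else 0) -
    (if (j : ℕ) = i + 1 then 1 else 0)

theorem isUnit_secondDifference (m : ℕ) : IsUnit (secondDifference m) := by
  rw [← Matrix.mulVec_injective_iff_isUnit]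
  refine (injective_iff_map_eq_zero (secondDifference m).mulVecLin).mpr fun v hv => ?_
  let V : ℕ → ℂ := fun k => ∑ j : Fin m, if (j : ℕ) + 1 = k then v j else 0
  have hV : ∀ i : Fin m, V (i + 1) = v i := fun i => by
    simp [V, Fin.val_inj]
  have hV0 : V 0 = 0 := by simp [V]
  have hVm : V (m + 1) = 0 :=
    Finset.sum_eq_zero fun j _ => if_neg (by have := j.isLt; omega)
  have hrec : ∀ k < m, V (k + 2) = 2 * V (k + 1) - V k := fun k hk => by
    have h : ∑ j, secondDifference m ⟨k, hk⟩ j * v j = 0 := congrFun hv ⟨k, hk⟩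
    have h' : ∑ j, secondDifference m ⟨k, hk⟩ j * v j = 2 * V (k + 1) - V k - V (k + 2) := by
      simp only [V, secondDifference, Finset.mul_sum, ← Finset.sum_sub_distrib]
      refine Finset.sum_congr rfl fun j _ => ?_
      simp [sub_mul]
    linear_combination h' - h
  have hlin : ∀ k ≤ m, V k = k * V 1 ∧ V (k + 1) = (k + 1) * V 1 := fun k => by
    induction k with
    | zero => simp [hV0]
    | succ k ih =>
      intro hk
      obtain ⟨h0, h1⟩ := ih (by omega)
      refine ⟨by rw [h1]; push_cast; ring, ?_⟩
      rw [hrec k (by omega), h0, h1]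
      push_cast
      ring
  have hV1 : V 1 = 0 := by
    have h := (hlin m le_rfl).2
    rw [hVm] at h
    exact (mul_eq_zero.mp h.symm).resolve_left (Nat.cast_add_one_ne_zero m)
  ext i
  rw [← hV i, (hlin i i.isLt.le).2, hV1, mul_zero, Pi.zero_apply]

theorem zVar_eq_sum (n k : ℕ) :
    zVar n k = ∑ j : Fin (n - 1), C (if (j : ℕ) + 1 = k then 1 else 0) * X (.inr (.inr j)) := by
  unfold zVar
  split_ifs with h
  · rw [Finset.sum_eq_single ⟨k - 1, by omega⟩]
    · simp [Nat.sub_add_cancel h.1]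
    · intro j _ hj
      rw [if_neg, C_0, zero_mul]
      exact fun h' => hj (Fin.ext (by simp only; omega))
    · simp
  · refine (Finset.sum_eq_zero fun j _ => ?_).symm
    rw [if_neg (by have := j.isLt; omega), C_0, zero_mul]

theorem LPoly_eq_linearSubst (n : ℕ) (i : Fin (n - 1)) :
    LPoly n (i + 1) = linearSubst (Fin (n - 1)) (Fin (n - 1)) (secondDifference (n - 1))
      (X (.inr (.inr i))) := by
  rw [LPoly, zVar_eq_sum, zVar_eq_sum, zVar_eq_sum, linearSubst_X_inr_inr, Finset.mul_sum,
    ← Finset.sum_sub_distrib, ← Finset.sum_sub_distrib]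
  refine Finset.sum_congr rfl fun j _ => ?_
  have h2 : (2 : MvPolynomial (PVars n) ℂ) = C 2 := (map_ofNat C 2).symm
  simp only [secondDifference, C_sub, C_mul, h2, Nat.add_sub_cancel, Nat.add_right_cancel_iff]
  ring

/-- The ideal `I^{(2)} = (L_i x_i, L_i y_i : i = 1,…,n−1)` of
`ℂ[x_1,…,x_{n−1}, y_1,…,y_{n−1}, z_1,…,z_{n−1}]` is a radical ideal. -/
theorem stmt_6 (n : ℕ) (hn : 2 ≤ n) :
    (Ideal.span {p : MvPolynomial (PVars n) ℂ |
        ∃ i : Fin (n - 1),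
          p = LPoly n ((i : ℕ) + 1) * xVar n i ∨
          p = LPoly n ((i : ℕ) + 1) * yVar n i}).IsRadical := by
  let s : Set (PVars n →₀ ℕ) := {a | ∃ i : Fin (n - 1),
    a = Finsupp.single (.inr (.inr i)) 1 + Finsupp.single (.inl i) 1 ∨
    a = Finsupp.single (.inr (.inr i)) 1 + Finsupp.single (.inr (.inl i)) 1}
  have hs : ∀ a ∈ s, ∀ v, a v ≤ 1 := by
    rintro _ ⟨i, rfl | rfl⟩ (v | v | v) <;> simp [Finsupp.single_apply] <;> split_ifs <;> simp
  convert isRadical_map_linearSubst (isUnit_secondDifference (n - 1))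
    (isRadical_span_monomial_image (R := ℂ) s hs)
  rw [Ideal.map_span, Set.image_image]
  congr 1
  ext p
  simp only [LPoly_eq_linearSubst, xVar, yVar, Set.mem_ofPred_eq, Set.mem_image, s]
  constructor
  · rintro ⟨i, rfl | rfl⟩
    · exact ⟨_, ⟨i, .inl rfl⟩, by simp [monomial_add_single, ← X_pow_eq_monomial]⟩
    · exact ⟨_, ⟨i, .inr rfl⟩, by simp [monomial_add_single, ← X_pow_eq_monomial]⟩
  · rintro ⟨_, ⟨i, rfl | rfl⟩, rfl⟩
    · exact ⟨i, .inl (by simp [monomial_add_single, ← X_pow_eq_monomial])⟩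
    · exact ⟨i, .inr (by simp [monomial_add_single, ← X_pow_eq_monomial])⟩

end
end

section
/- Let n ≥ 2, R = ℂ[x_1,…,x_{n−1}, y_1,…,y_{n−1}, z_1,…,z_{n−1}], and with the convention z_0 = z_n = 0 set L_i = 2z_i − z_{i−1} − z_{i+1}. Let I^{(2)} = (L_i x_i, L_i y_i : i = 1,…,n−1) and, for each subset ι ⊆ {1,…,n−1}, let I_ι = (L_i for i ∈ ι; x_j, y_j for j ∉ ι). Then I^{(2)} equals the intersection of the 2^{n−1} ideals I_ι over all subsets ι ⊆ {1,…,n−1}. -/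
open MvPolynomial

noncomputable section

/-- The ideal `I_ι = (L_i for i ∈ ι; x_j, y_j for j ∉ ι)` for a subset `ι ⊆ {1,…,n−1}`. -/
def Iiota (n : ℕ) (ι : Set (Fin (n - 1))) : Ideal (MvPolynomial (PVars n) ℂ) :=
  Ideal.span ({p : MvPolynomial (PVars n) ℂ | ∃ i ∈ ι, p = LPoly n ((i : ℕ) + 1)} ∪
    {p : MvPolynomial (PVars n) ℂ | ∃ j ∉ ι, p = xVar n j ∨ p = yVar n j})

/-- The linear change of coordinates that fixes each `x_i`, `y_i` and sends `z_i` to `L_i`. -/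
def zToL (n : ℕ) : MvPolynomial (PVars n) ℂ →ₐ[ℂ] MvPolynomial (PVars n) ℂ :=
  aeval (Sum.elim (xVar n) (Sum.elim (yVar n) fun i => LPoly n ((i : ℕ) + 1)))

@[simp] lemma zToL_x (n : ℕ) (i : Fin (n - 1)) : zToL n (X (Sum.inl i)) = xVar n i := by
  simp [zToL]

@[simp] lemma zToL_y (n : ℕ) (i : Fin (n - 1)) :
    zToL n (X (Sum.inr (Sum.inl i))) = yVar n i := by
  simp [zToL]

@[simp] lemma zToL_z (n : ℕ) (i : Fin (n - 1)) :
    zToL n (X (Sum.inr (Sum.inr i))) = LPoly n ((i : ℕ) + 1) := by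
  simp [zToL]

lemma LPoly_mem_range_zToL {n k : ℕ} (hk : k + 1 < n) : LPoly n (k + 1) ∈ (zToL n).range :=
  ⟨X (Sum.inr (Sum.inr ⟨k, by omega⟩)), zToL_z n _⟩

/-- Modulo the span of the `L_i`, the sequence `z_k` is arithmetic. -/
lemma zVar_sub_mem_range_zToL (n k : ℕ) (hk : k < n) :
    zVar n k - (k : ℂ) • zVar n 1 ∈ (zToL n).range ∧
      zVar n (k + 1) - ((k + 1 : ℕ) : ℂ) • zVar n 1 ∈ (zToL n).range := by
  induction k with
  | zero => simp [zVar, zero_mem]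
  | succ k ih =>
    obtain ⟨h₀, h₁⟩ := ih (by omega)
    refine ⟨h₁, ?_⟩
    convert sub_mem (sub_mem (add_mem h₁ h₁) h₀) (LPoly_mem_range_zToL hk) using 1
    simp only [LPoly, Nat.add_sub_cancel, Nat.cast_add, Nat.cast_one, add_smul, one_smul]
    ring

lemma zVar_mem_range_zToL {n k : ℕ} (hk : k < n) : zVar n k ∈ (zToL n).range := by
  have hn : (n : ℂ) ≠ 0 := by exact_mod_cast (by omega : n ≠ 0)
  have h_one : zVar n 1 ∈ (zToL n).range := by
    have h := (zVar_sub_mem_range_zToL n (n - 1) (by omega)).2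
    have hz : zVar n n = 0 := dif_neg (by omega)
    rw [Nat.sub_add_cancel (by omega), hz, zero_sub] at h
    simpa [smul_smul, hn] using Subalgebra.smul_mem _ (neg_mem h) (n : ℂ)⁻¹
  simpa using add_mem (zVar_sub_mem_range_zToL n k hk).1
    (Subalgebra.smul_mem _ h_one (k : ℂ))

lemma zToL_surjective (n : ℕ) : Function.Surjective (zToL n) := by
  rw [← AlgHom.range_eq_top, eq_top_iff, ← adjoin_range_X, Algebra.adjoin_le_iff]
  rintro _ ⟨i | i | i, rfl⟩
  · exact ⟨_, zToL_x n i⟩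
  · exact ⟨_, zToL_y n i⟩
  · have hi : (i : ℕ) + 1 ≤ n - 1 := i.isLt
    simpa [zVar, hi] using zVar_mem_range_zToL (n := n) (k := i + 1) (by omega)

/-- A surjective endomorphism of a Noetherian ring is injective. -/
lemma injective_of_surjective_of_isNoetherianRing {A : Type*} [CommRing A] [IsNoetherianRing A]
    (f : A →+* A) (hf : Function.Surjective f) : Function.Injective f := by
  let K : ℕ →o Ideal A :=
    ⟨fun k => RingHom.ker (f ^ k), monotone_nat_of_le_succ fun k a ha => by
      rw [RingHom.mem_ker] at ha ⊢
      rw [pow_succ', RingHom.mul_def, RingHom.comp_apply, ha, map_zero]⟩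
  obtain ⟨k, hk⟩ := monotone_stabilizes_iff_noetherian.mpr ‹IsNoetherianRing A› K
  rw [injective_iff_map_eq_zero]
  intro a ha
  obtain ⟨b, rfl⟩ : ∃ b, (f ^ k) b = a := by
    rw [RingHom.coe_pow]
    exact hf.iterate k a
  have hb : b ∈ K (k + 1) := by
    change (f ^ (k + 1)) b = 0
    rwa [pow_succ', RingHom.mul_def, RingHom.comp_apply]
  rwa [← hk (k + 1) k.le_succ] at hb

lemma zToL_bijective (n : ℕ) : Function.Bijective (zToL n) :=
  ⟨injective_of_surjective_of_isNoetherianRing (zToL n).toRingHom (zToL_surjective n),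
    zToL_surjective n⟩

/-- The variables generating the monomial counterpart of `Iiota n ι`. -/
def iotaVars (n : ℕ) (ι : Set (Fin (n - 1))) : Set (PVars n) :=
  {v | (∃ i ∈ ι, v = Sum.inr (Sum.inr i)) ∨ ∃ j ∉ ι, v = Sum.inl j ∨ v = Sum.inr (Sum.inl j)}

lemma Iiota_le_map_zToL (n : ℕ) (ι : Set (Fin (n - 1))) :
    Iiota n ι ≤ (Ideal.span (X '' iotaVars n ι)).map (zToL n) := by
  have key : ∀ v ∈ iotaVars n ι,
      zToL n (X v) ∈ (Ideal.span (X '' iotaVars n ι)).map (zToL n) := fun v hv =>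
    Ideal.mem_map_of_mem _ (Ideal.subset_span ⟨v, hv, rfl⟩)
  refine Ideal.span_le.2 ?_
  rintro _ (⟨i, hi, rfl⟩ | ⟨j, hj, rfl | rfl⟩)
  · rw [← zToL_z]
    exact key _ (Or.inl ⟨i, hi, rfl⟩)
  · rw [← zToL_x]
    exact key _ (Or.inr ⟨j, hj, Or.inl rfl⟩)
  · rw [← zToL_y]
    exact key _ (Or.inr ⟨j, hj, Or.inr rfl⟩)

/-- The exponents of the monomials `z_i x_i` and `z_i y_i`. -/
def zxyExponents (n : ℕ) : Set (PVars n →₀ ℕ) :=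
  {m | ∃ i, m = Finsupp.single (Sum.inr (Sum.inr i)) 1 + Finsupp.single (Sum.inl i) 1 ∨
    m = Finsupp.single (Sum.inr (Sum.inr i)) 1 + Finsupp.single (Sum.inr (Sum.inl i)) 1}

lemma single_add_single_le {σ : Type*} {a b : σ} {m : σ →₀ ℕ} (hab : a ≠ b)
    (ha : m a ≠ 0) (hb : m b ≠ 0) : Finsupp.single a 1 + Finsupp.single b 1 ≤ m := by
  classical
  intro v
  simp only [Finsupp.add_apply, Finsupp.single_apply]
  split_ifs with h₁ h₂ h₂ <;> grind

lemma mem_span_zxyExponents {n : ℕ} {g : MvPolynomial (PVars n) ℂ}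
    (hg : ∀ ι, g ∈ Ideal.span (X '' iotaVars n ι)) :
    g ∈ Ideal.span ((fun m => monomial m (1 : ℂ)) '' zxyExponents n) := by
  rw [mem_ideal_span_monomial_image]
  intro m hm
  obtain ⟨v, hv, hmv⟩ := mem_ideal_span_X_image.1
    (hg {i | m (Sum.inr (Sum.inr i)) = 0}) m hm
  rcases hv with ⟨i, hi, rfl⟩ | ⟨j, hj, rfl | rfl⟩
  · exact absurd hi hmv
  · exact ⟨_, ⟨j, Or.inl rfl⟩, single_add_single_le (by simp) hj hmv⟩
  · exact ⟨_, ⟨j, Or.inr rfl⟩, single_add_single_le (by simp) hj hmv⟩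

/-- The ideal `I^{(2)} = (L_i x_i, L_i y_i : i = 1,…,n−1)` equals the intersection of the
`2^{n−1}` prime ideals `I_ι` over all subsets `ι ⊆ {1,…,n−1}`. -/
theorem stmt_9 (n : ℕ) (hn : 2 ≤ n) :
    Ideal.span {p : MvPolynomial (PVars n) ℂ |
        ∃ i : Fin (n - 1),
          p = LPoly n ((i : ℕ) + 1) * xVar n i ∨
          p = LPoly n ((i : ℕ) + 1) * yVar n i} =
      ⨅ ι : Set (Fin (n - 1)), Iiota n ι := by
  apply le_antisymm
  · refine Ideal.span_le.2 ?_
    rintro _ ⟨i, hp⟩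
    refine Ideal.mem_iInf.2 fun ι => ?_
    by_cases hi : i ∈ ι
    · have hL : LPoly n ((i : ℕ) + 1) ∈ Iiota n ι :=
        Ideal.subset_span (Or.inl ⟨i, hi, rfl⟩)
      rcases hp with rfl | rfl <;> exact Ideal.mul_mem_right _ _ hL
    · rcases hp with rfl | rfl
      · exact Ideal.mul_mem_left _ _ (Ideal.subset_span (Or.inr ⟨i, hi, Or.inl rfl⟩))
      · exact Ideal.mul_mem_left _ _ (Ideal.subset_span (Or.inr ⟨i, hi, Or.inr rfl⟩))
  · intro f hf
    obtain ⟨g, rfl⟩ := zToL_surjective n f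
    have hg : ∀ ι, g ∈ Ideal.span (X '' iotaVars n ι) := fun ι => by
      rw [← Ideal.comap_map_of_bijective (zToL n) (zToL_bijective n)
        (I := Ideal.span (X '' iotaVars n ι))]
      exact Iiota_le_map_zToL n ι (Ideal.mem_iInf.1 hf ι)
    rw [← Ideal.mem_comap]
    refine Ideal.span_le.2 ?_ (mem_span_zxyExponents hg)
    rintro _ ⟨_, ⟨i, rfl | rfl⟩, rfl⟩ <;> refine Ideal.subset_span ⟨i, ?_⟩
    · left
      rw [← zToL_z, ← zToL_x, ← map_mul, X, X, monomial_mul, one_mul]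
    · right
      rw [← zToL_z, ← zToL_y, ← map_mul, X, X, monomial_mul, one_mul]

end
end

section
/- Let σ and τ be index sets, and let I be a radical ideal of the polynomial ring ℂ[X_s : s ∈ σ]. Then the ideal of ℂ[X_s, T_t : s ∈ σ, t ∈ τ] generated by the image of I under the canonical embedding ℂ[X_s : s ∈ σ] → ℂ[X_s, T_t : s ∈ σ, t ∈ τ] is again a radical ideal. -/
/-- Extending a radical ideal of the coefficient ring to a polynomial ring gives a radical ideal. -/
theorem Ideal.IsRadical.map_mvPolynomial_C {R : Type*} [CommRing R] {I : Ideal R}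
    (hI : I.IsRadical) (τ : Type*) :
    (I.map (MvPolynomial.C : R →+* MvPolynomial τ R)).IsRadical := by
  have : IsReduced (R ⧸ I) := (Ideal.isRadical_iff_quotient_reduced I).mp hI
  have h : RingHom.ker (MvPolynomial.map (σ := τ) (Ideal.Quotient.mk I)) =
      I.map MvPolynomial.C := by
    rw [MvPolynomial.ker_map, Ideal.mk_ker]
  rw [← h, RingHom.ker_eq_comap_bot]
  exact Ideal.isRadical_bot.comap _

/-- If `I` is a radical ideal of `ℂ[X_s : s ∈ σ]`, then the ideal of
`ℂ[X_s, T_t : s ∈ σ, t ∈ τ]` generated by the image of `I` under the canonical embedding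
(the `ℂ`-algebra map sending each variable `X_s` to itself) is again a radical ideal. -/
theorem stmt_12 {σ τ : Type*} (I : Ideal (MvPolynomial σ ℂ)) (hI : I.IsRadical) :
    (Ideal.map
      (MvPolynomial.rename (Sum.inl : σ → σ ⊕ τ) : MvPolynomial σ ℂ →ₐ[ℂ]
        MvPolynomial (σ ⊕ τ) ℂ) I).IsRadical := by
  let e : MvPolynomial (σ ⊕ τ) ℂ ≃ₐ[ℂ] MvPolynomial τ (MvPolynomial σ ℂ) :=
    (MvPolynomial.renameEquiv ℂ (Equiv.sumComm σ τ)).trans (MvPolynomial.sumAlgEquiv ℂ τ σ)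
  have he : e.toRingEquiv.toRingHom.comp
      (MvPolynomial.rename (Sum.inl : σ → σ ⊕ τ)).toRingHom = MvPolynomial.C := by
    refine MvPolynomial.ringHom_ext (fun r => ?_) (fun s => ?_) <;> simp [e]
  have h : Ideal.map (MvPolynomial.rename (Sum.inl : σ → σ ⊕ τ)) I =
      (I.map MvPolynomial.C).comap e.toRingEquiv.toRingHom := by
    rw [← he, ← Ideal.map_map]
    exact (Ideal.comap_map_of_bijective _ e.bijective).symm
  rw [h]
  exact (hI.map_mvPolynomial_C τ).comap _
end

section
/- Let Γ be a group and h : Γ → ℤ a surjective group homomorphism. For μ ∈ ℂ*, let ℂ_μ denote the one-dimensional Γ-representation on ℂ where γ acts by multiplication by μ^{h(γ)}. Let n ≥ 2 and let λ_1,…,λ_n ∈ ℂ* be pairwise distinct with λ_1⋯λ_n = 1; set α_i = λ_i/λ_{i+1} for i = 1,…,n−1. Assume: (i) dim_ℂ H¹(Γ;ℂ) = 1 and H²(Γ;ℂ) = 0 for the trivial coefficients ℂ; (ii) for all i, j with |i−j| ≥ 2, H¹(Γ;ℂ_{λ_i/λ_j}) = 0 and H²(Γ;ℂ_{λ_i/λ_j})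 = 0; (iii) for each i = 1,…,n−1 and each ε ∈ {+1,−1}, dim_ℂ H¹(Γ;ℂ_{α_i^ε}) = 1, dim_ℂ H²(Γ;ℂ_{α_i^ε}) = 1, and for every 1-cocycle u ∈ Z¹(Γ;ℂ_{α_i^ε}) that is not a coboundary, the 2-cocycle (γ₁,γ₂) ↦ h(γ₁)·α_i^{ε h(γ₁)}·u(γ₂) is not a 2-coboundary. Let u_i^+ ∈ Z¹(Γ;ℂ_{α_i}) be cocycles that are not coboundaries, and let ρ : Γ → GL(n,ℂ) be a group homomorphism of the form ρ(γ) = Z(γ)·D^{h(γ)}, where D = diag(λ_1,…,λ_n) and Z(γ) is upper unitriangular with (i,i+1) entry u_i^+(γ). Consider M_n(ℂ) as a Γ-representation via γ·X = ρ(γ)·X·ρ(γ)^{-1}. Then H⁰(Γ; M_n(ℂ)) is one-dimensional (spanned by the identity matrix) and H¹(Γ; M_n(ℂ)) is n-dimensional; equivalently, for the Ad ρ action on the traceless matrices sl(n,ℂ), H⁰(Γ; sl(n,ℂ)) = 0 and dim_ℂ H¹(Γ; sl(n,ℂ)) = n−1. -/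
namespace GroupCochain

variable {k G V : Type} [Field k] [Group G] [AddCommGroup V] [Module k V]
  (σ : Representation k G V)

/-- The coboundary from elements to inhomogeneous 1-cochains. -/
def d₀ : V →ₗ[k] (G → V) where
  toFun a g := σ g a - a
  map_add' a b := by ext g; simp; abel
  map_smul' r a := by ext g; simp [smul_sub]

/-- The coboundary from inhomogeneous 1-cochains to 2-cochains. -/
def d₁ : (G → V) →ₗ[k] (G → G → V) where
  toFun f g₁ g₂ := σ g₁ (f g₂) - f (g₁ * g₂) + f g₁
  map_add' a b := by ext g₁ g₂; simp; abel
  map_smul' r a := by ext g₁ g₂; simp [smul_sub, smul_add]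

/-- The coboundary from inhomogeneous 2-cochains to 3-cochains. -/
def d₂ : (G → G → V) →ₗ[k] (G → G → G → V) where
  toFun c g₁ g₂ g₃ := σ g₁ (c g₂ g₃) - c (g₁ * g₂) g₃ + c g₁ (g₂ * g₃) - c g₁ g₂
  map_add' a b := by ext g₁ g₂ g₃; simp; abel
  map_smul' r a := by ext g₁ g₂ g₃; simp [smul_sub, smul_add]

variable {σ}

theorem d₀_apply (a : V) (g : G) : d₀ σ a g = σ g a - a := rfl

theorem d₁_apply (f : G → V) (g₁ g₂ : G) :
    d₁ σ f g₁ g₂ = σ g₁ (f g₂) - f (g₁ * g₂) + f g₁ := rfl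

theorem d₂_apply (c : G → G → V) (g₁ g₂ g₃ : G) :
    d₂ σ c g₁ g₂ g₃ =
      σ g₁ (c g₂ g₃) - c (g₁ * g₂) g₃ + c g₁ (g₂ * g₃) - c g₁ g₂ := rfl

@[simp]
theorem d₁_d₀ (a : V) : d₁ σ (d₀ σ a) = 0 := by
  ext g₁ g₂; simp [d₁_apply, d₀_apply]

@[simp]
theorem d₂_d₁ (f : G → V) : d₂ σ (d₁ σ f) = 0 := by
  ext g₁ g₂ g₃; simp [d₂_apply, d₁_apply, mul_assoc]; abel

theorem mem_cocycles₁_iff_d₁ (f : G → V) :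
    f ∈ groupCohomology.cocycles₁ (Rep.of σ) ↔ d₁ σ f = 0 := by
  rw [groupCohomology.mem_cocycles₁_def]
  simp [funext_iff, d₁_apply]

theorem mem_cocycles₂_iff_d₂ (c : G → G → V) :
    (fun p : G × G => c p.1 p.2) ∈ groupCohomology.cocycles₂ (Rep.of σ) ↔ d₂ σ c = 0 := by
  rw [groupCohomology.mem_cocycles₂_def]
  simp [funext_iff, d₂_apply]

theorem H1π_eq_zero_iff_exists (z : groupCohomology.cocycles₁ (Rep.of σ)) :
    groupCohomology.H1π (Rep.of σ) z = 0 ↔ ∃ a, (z : G → V) = d₀ σ a := by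
  rw [groupCohomology.H1π_eq_zero_iff]
  exact exists_congr fun a => eq_comm

theorem H2π_eq_zero_iff_exists (z : groupCohomology.cocycles₂ (Rep.of σ)) :
    groupCohomology.H2π (Rep.of σ) z = 0 ↔
      ∃ f, ∀ g₁ g₂, (z : G × G → V) (g₁, g₂) = d₁ σ f g₁ g₂ := by
  rw [groupCohomology.H2π_eq_zero_iff]
  refine exists_congr fun a => ?_
  rw [eq_comm, funext_iff, Prod.forall]
  rfl

theorem exists_eq_d₀_of_subsingleton_H1 (hs : Subsingleton (groupCohomology.H1 (Rep.of σ)))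
    {z : G → V} (hz : d₁ σ z = 0) : ∃ a, z = d₀ σ a :=
  (H1π_eq_zero_iff_exists ⟨z, (mem_cocycles₁_iff_d₁ z).2 hz⟩).1 (Subsingleton.elim _ _)

theorem exists_eq_d₁_of_subsingleton_H2 (hs : Subsingleton (groupCohomology.H2 (Rep.of σ)))
    {c : G → G → V} (hc : d₂ σ c = 0) : ∃ f, c = d₁ σ f := by
  obtain ⟨f, hf⟩ := (H2π_eq_zero_iff_exists
    ⟨fun p : G × G => c p.1 p.2, (mem_cocycles₂_iff_d₂ c).2 hc⟩).1 (Subsingleton.elim _ _)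
  exact ⟨f, funext₂ hf⟩

/-- If `H¹` is a line, every 1-cocycle is cohomologous to a multiple of a given nontrivial one. -/
theorem exists_eq_smul_add_d₀ (hr : Module.finrank k (groupCohomology.H1 (Rep.of σ)) = 1)
    {u : G → V} (hu : d₁ σ u = 0) (hu0 : ¬ ∃ a, u = d₀ σ a)
    {z : G → V} (hz : d₁ σ z = 0) : ∃ (s : k) (a : V), z = s • u + d₀ σ a := by
  let U : groupCohomology.cocycles₁ (Rep.of σ) := ⟨u, (mem_cocycles₁_iff_d₁ u).2 hu⟩
  let W : groupCohomology.cocycles₁ (Rep.of σ) := ⟨z, (mem_cocycles₁_iff_d₁ z).2 hz⟩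
  have hU : groupCohomology.H1π (Rep.of σ) U ≠ 0 := fun h0 =>
    hu0 ((H1π_eq_zero_iff_exists U).1 h0)
  obtain ⟨s, hs⟩ := (finrank_eq_one_iff_of_nonzero' _ hU).1 hr (groupCohomology.H1π (Rep.of σ) W)
  have h0 : groupCohomology.H1π (Rep.of σ) (W - s • U) = 0 := by
    rw [map_sub, map_smul, hs, sub_self]
  obtain ⟨a, ha⟩ := (H1π_eq_zero_iff_exists _).1 h0
  exact ⟨s, a, by rw [← ha]; exact (add_sub_cancel (s • u) z).symm⟩

/-- If `H²` is a line, every 2-cocycle is cohomologous to a multiple of a given nontrivial one. -/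
theorem exists_eq_smul_add_d₁ (hr : Module.finrank k (groupCohomology.H2 (Rep.of σ)) = 1)
    {u : G → G → V} (hu : d₂ σ u = 0) (hu0 : ¬ ∃ f, u = d₁ σ f)
    {c : G → G → V} (hc : d₂ σ c = 0) : ∃ (s : k) (f : G → V), c = s • u + d₁ σ f := by
  let U : groupCohomology.cocycles₂ (Rep.of σ) :=
    ⟨fun p : G × G => u p.1 p.2, (mem_cocycles₂_iff_d₂ u).2 hu⟩
  let W : groupCohomology.cocycles₂ (Rep.of σ) :=
    ⟨fun p : G × G => c p.1 p.2, (mem_cocycles₂_iff_d₂ c).2 hc⟩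
  have hU : groupCohomology.H2π (Rep.of σ) U ≠ 0 := fun h0 => by
    obtain ⟨f, hf⟩ := (H2π_eq_zero_iff_exists U).1 h0
    exact hu0 ⟨f, funext₂ hf⟩
  obtain ⟨s, hs⟩ := (finrank_eq_one_iff_of_nonzero' _ hU).1 hr (groupCohomology.H2π (Rep.of σ) W)
  have h0 : groupCohomology.H2π (Rep.of σ) (W - s • U) = 0 := by
    rw [map_sub, map_smul, hs, sub_self]
  obtain ⟨f, hf⟩ := (H2π_eq_zero_iff_exists _).1 h0
  refine ⟨s, f, ?_⟩
  ext g₁ g₂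
  simp only [Pi.add_apply, ← hf]
  exact (add_sub_cancel (s • u g₁ g₂) (c g₁ g₂)).symm

/-- Cocycles forming a basis modulo coboundaries count the dimension of `H¹`. -/
theorem finrank_H1_eq_of_basis {m : ℕ} (b : Fin m → G → V) (hb : ∀ i, d₁ σ (b i) = 0)
    (hspan : ∀ z, d₁ σ z = 0 → ∃ (s : Fin m → k) (a : V), z = ∑ i, s i • b i + d₀ σ a)
    (hind : ∀ (s : Fin m → k) (a : V), ∑ i, s i • b i = d₀ σ a → s = 0) :
    Module.finrank k (groupCohomology.H1 (Rep.of σ)) = m := by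
  let B : Fin m → groupCohomology.cocycles₁ (Rep.of σ) :=
    fun i => ⟨b i, (mem_cocycles₁_iff_d₁ _).2 (hb i)⟩
  let L : (Fin m → k) →ₗ[k] groupCohomology.H1 (Rep.of σ) :=
    (groupCohomology.H1π (Rep.of σ)).hom ∘ₗ Fintype.linearCombination k B
  have hB : ∀ s : Fin m → k,
      ((Fintype.linearCombination k B s : groupCohomology.cocycles₁ (Rep.of σ)) : G → V) =
        ∑ i, s i • b i := fun s => by
    rw [Fintype.linearCombination_apply, ← groupCohomology.cocycles₁.val_eq_coe,
      AddSubmonoidClass.coe_finsetSum]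
    rfl
  have hinj : Function.Injective L := by
    rw [← LinearMap.ker_eq_bot, LinearMap.ker_eq_bot']
    intro s hs
    obtain ⟨a, ha⟩ := (H1π_eq_zero_iff_exists _).1 hs
    exact hind s a (by rw [← ha, hB])
  have hsurj : Function.Surjective L := by
    intro x
    induction x using groupCohomology.H1_induction_on with
    | h x =>
      obtain ⟨s, a, ha⟩ := hspan x ((mem_cocycles₁_iff_d₁ _).1 x.2)
      refine ⟨s, ?_⟩
      rw [← sub_eq_zero]
      change groupCohomology.H1π (Rep.of σ) _ - groupCohomology.H1π (Rep.of σ) x = 0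
      rw [← map_sub, H1π_eq_zero_iff_exists]
      refine ⟨-a, ?_⟩
      change ((Fintype.linearCombination k B s : groupCohomology.cocycles₁ (Rep.of σ)) : G → V)
        - (x : G → V) = _
      rw [hB, ha, map_neg]
      abel
  simpa using (LinearEquiv.ofBijective L ⟨hinj, hsurj⟩).finrank_eq.symm

variable (σ) in
/-- For subspaces `B ≤ A` of a representation: the quotient complex of `A`-valued by `B`-valued
inhomogeneous cochains has no cohomology in degrees `0`, `1` and `2`. -/
structure AcyclicPair (A B : Submodule k V) : Prop where
  zero : ∀ x ∈ A, (∀ g, d₀ σ x g ∈ B) → x ∈ B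
  one : ∀ z : G → V, (∀ g, z g ∈ A) → (∀ g₁ g₂, d₁ σ z g₁ g₂ ∈ B) →
    ∃ a ∈ A, ∀ g, (z - d₀ σ a) g ∈ B
  two : ∀ c : G → G → V, (∀ g₁ g₂, c g₁ g₂ ∈ A) → (∀ g₁ g₂ g₃, d₂ σ c g₁ g₂ g₃ ∈ B) →
    ∃ f : G → V, (∀ g, f g ∈ A) ∧ ∀ g₁ g₂, (c - d₁ σ f) g₁ g₂ ∈ B

theorem AcyclicPair.refl (A : Submodule k V) : AcyclicPair σ A A where
  zero x hx _ := hx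
  one z hz _ := ⟨0, A.zero_mem, by simpa using hz⟩
  two c hc _ := ⟨0, fun _ => A.zero_mem, by simpa using hc⟩

theorem exists_sub_d₁_mem_trans {A B C : Submodule k V} (hBA : B ≤ A) (hCB : C ≤ B)
    (hAB : ∀ c : G → G → V, (∀ g₁ g₂, c g₁ g₂ ∈ A) → (∀ g₁ g₂ g₃, d₂ σ c g₁ g₂ g₃ ∈ B) →
      ∃ f : G → V, (∀ g, f g ∈ A) ∧ ∀ g₁ g₂, (c - d₁ σ f) g₁ g₂ ∈ B)
    (hBC : ∀ c : G → G → V, (∀ g₁ g₂, c g₁ g₂ ∈ B) → (∀ g₁ g₂ g₃, d₂ σ c g₁ g₂ g₃ ∈ C) →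
      ∃ f : G → V, (∀ g, f g ∈ B) ∧ ∀ g₁ g₂, (c - d₁ σ f) g₁ g₂ ∈ C)
    (c : G → G → V) (hcA : ∀ g₁ g₂, c g₁ g₂ ∈ A) (hc : ∀ g₁ g₂ g₃, d₂ σ c g₁ g₂ g₃ ∈ C) :
    ∃ f : G → V, (∀ g, f g ∈ A) ∧ ∀ g₁ g₂, (c - d₁ σ f) g₁ g₂ ∈ C := by
  obtain ⟨f, hfA, hf⟩ := hAB c hcA fun _ _ _ => hCB (hc _ _ _)
  obtain ⟨f', hf'B, hf'⟩ := hBC (c - d₁ σ f) hf (by simpa using hc)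
  exact ⟨f + f', fun g => A.add_mem (hfA g) (hBA (hf'B g)), by rwa [map_add, ← sub_sub]⟩

theorem AcyclicPair.trans {A B C : Submodule k V} (hAB : AcyclicPair σ A B)
    (hBC : AcyclicPair σ B C) (hBA : B ≤ A) (hCB : C ≤ B) : AcyclicPair σ A C where
  zero x hx h := hBC.zero x (hAB.zero x hx fun g => hCB (h g)) h
  one z hzA hz := by
    obtain ⟨a, haA, ha⟩ := hAB.one z hzA fun _ _ => hCB (hz _ _)
    obtain ⟨a', ha'B, ha'⟩ := hBC.one (z - d₀ σ a) ha (by simpa using hz)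
    exact ⟨a + a', A.add_mem haA (hBA ha'B), by rwa [map_add, ← sub_sub]⟩
  two := exists_sub_d₁_mem_trans hBA hCB hAB.two hBC.two

end GroupCochain

namespace GroupCochain

section NonsplitExtension

variable {k G : Type} [Field k] [Group G] {τ₀ τ : Representation k G k} {χ u H : G → k}

theorem character_mul (hτ : ∀ g x, τ g x = χ g * x) (g₁ g₂ : G) :
    χ (g₁ * g₂) = χ g₁ * χ g₂ := by
  have h : τ (g₁ * g₂) 1 = τ g₁ (τ g₂ 1) := by rw [map_mul]; rfl
  simpa only [hτ, mul_one] using h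

theorem eq_zero_of_d₀_eq_zero (hτ : ∀ g x, τ g x = χ g * x) (hχ : ∃ g, χ g ≠ 1) {x : k}
    (hx : ∀ g, d₀ τ x g = 0) : x = 0 := by
  obtain ⟨g, hg⟩ := hχ
  have := hx g
  rw [d₀_apply, hτ, ← sub_one_mul] at this
  exact (mul_eq_zero.1 this).resolve_left (sub_ne_zero.2 hg)

theorem d₁_additive_eq_zero (hτ₀ : ∀ g x, τ₀ g x = x) (hH : ∀ g₁ g₂, H (g₁ * g₂) = H g₁ + H g₂) :
    d₁ τ₀ H = 0 := by
  ext g₁ g₂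
  simp [d₁_apply, hτ₀, hH]

theorem exists_eq_smul_of_additive (hτ₀ : ∀ g x, τ₀ g x = x)
    (hr : Module.finrank k (groupCohomology.H1 (Rep.of τ₀)) = 1)
    (hH : ∀ g₁ g₂, H (g₁ * g₂) = H g₁ + H g₂) (hH0 : ∃ g, H g ≠ 0)
    {p : G → k} (hp : d₁ τ₀ p = 0) : ∃ s : k, p = s • H := by
  obtain ⟨s, a, h⟩ := exists_eq_smul_add_d₀ hr (d₁_additive_eq_zero hτ₀ hH) (by
    rintro ⟨a, rfl⟩
    obtain ⟨g, hg⟩ := hH0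
    simp [d₀_apply, hτ₀] at hg) hp
  refine ⟨s, ?_⟩
  rw [h]
  ext g
  simp [d₀_apply, hτ₀]

/-- The cup products `H ∪ u` and `-u ∪ H` are cohomologous. -/
theorem d₁_mul_eq (hτ : ∀ g x, τ g x = χ g * x) (hH : ∀ g₁ g₂, H (g₁ * g₂) = H g₁ + H g₂)
    (hu : d₁ τ u = 0) (g₁ g₂ : G) :
    d₁ τ (H * u) g₁ g₂ = -(H g₁ * (χ g₁ * u g₂)) - u g₁ * H g₂ := by
  have := congrFun₂ hu g₁ g₂
  simp only [d₁_apply, hτ, Pi.zero_apply] at this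
  simp only [d₁_apply, hτ, Pi.mul_apply, hH]
  linear_combination (H g₁ + H g₂) * this

theorem d₂_cup_eq_zero (hτ : ∀ g x, τ g x = χ g * x) (hH : ∀ g₁ g₂, H (g₁ * g₂) = H g₁ + H g₂)
    (hu : d₁ τ u = 0) : d₂ τ (fun g₁ g₂ => H g₁ * (χ g₁ * u g₂)) = 0 := by
  ext g₁ g₂ g₃
  have := congrFun₂ hu g₂ g₃
  simp only [d₁_apply, hτ, Pi.zero_apply] at this
  simp only [d₂_apply, hτ, hH, character_mul hτ, Pi.zero_apply]
  linear_combination -H g₁ * χ g₁ * this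

theorem nonsplit_zero (hτ : ∀ g x, τ g x = χ g * x) (hχ : ∃ g, χ g ≠ 1)
    (hu0 : ¬ ∃ a, u = d₀ τ a) {x y : k} (h : ∀ g, d₀ τ y g - u g * x = 0) : x = 0 ∧ y = 0 := by
  have hx : x = 0 := by
    by_contra hx
    refine hu0 ⟨x⁻¹ * y, ?_⟩
    ext g
    have := h g
    rw [d₀_apply, hτ] at this ⊢
    field_simp
    linear_combination -this
  subst hx
  exact ⟨rfl, eq_zero_of_d₀_eq_zero hτ hχ fun g => by simpa using h g⟩

theorem nonsplit_one (hτ₀ : ∀ g x, τ₀ g x = x) (hτ : ∀ g x, τ g x = χ g * x)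
    (hr₀ : Module.finrank k (groupCohomology.H1 (Rep.of τ₀)) = 1)
    (hr : Module.finrank k (groupCohomology.H1 (Rep.of τ)) = 1)
    (hH : ∀ g₁ g₂, H (g₁ * g₂) = H g₁ + H g₂) (hH0 : ∃ g, H g ≠ 0)
    (hu : d₁ τ u = 0) (hu0 : ¬ ∃ a, u = d₀ τ a)
    (hcup : ¬ ∃ f, ∀ g₁ g₂, H g₁ * (χ g₁ * u g₂) = d₁ τ f g₁ g₂)
    {p w : G → k} (hp : d₁ τ₀ p = 0) (hw : ∀ g₁ g₂, d₁ τ w g₁ g₂ - u g₁ * p g₂ = 0) :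
    ∃ a b : k, ∀ g, p g = d₀ τ₀ a g ∧ w g = d₀ τ b g - u g * a := by
  obtain ⟨s, rfl⟩ := exists_eq_smul_of_additive hτ₀ hr₀ hH hH0 hp
  have hs : s = 0 := by
    by_contra hs
    refine hcup ⟨-(H * u) - s⁻¹ • w, fun g₁ g₂ => ?_⟩
    have h1 := d₁_mul_eq hτ hH hu g₁ g₂
    have h2 := hw g₁ g₂
    simp only [map_sub, map_neg, map_smul, Pi.sub_apply, Pi.neg_apply, Pi.smul_apply, smul_eq_mul]
      at h2 ⊢
    field_simp
    linear_combination s * h1 + h2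
  subst hs
  obtain ⟨t, b, rfl⟩ := exists_eq_smul_add_d₀ hr hu hu0 (z := w) (by
    ext g₁ g₂; simpa using hw g₁ g₂)
  refine ⟨-t, b, fun g => ⟨by simp [d₀_apply, hτ₀], ?_⟩⟩
  simp
  ring

theorem nonsplit_two (hτ₀ : ∀ g x, τ₀ g x = x) (hτ : ∀ g x, τ g x = χ g * x)
    (hs₀ : Subsingleton (groupCohomology.H2 (Rep.of τ₀)))
    (hr : Module.finrank k (groupCohomology.H2 (Rep.of τ)) = 1)
    (hH : ∀ g₁ g₂, H (g₁ * g₂) = H g₁ + H g₂) (hu : d₁ τ u = 0)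
    (hcup : ¬ ∃ f, ∀ g₁ g₂, H g₁ * (χ g₁ * u g₂) = d₁ τ f g₁ g₂)
    {c e : G → G → k} (hc : d₂ τ₀ c = 0)
    (he : ∀ g₁ g₂ g₃, d₂ τ e g₁ g₂ g₃ - u g₁ * c g₂ g₃ = 0) :
    ∃ f f' : G → k, ∀ g₁ g₂, c g₁ g₂ = d₁ τ₀ f g₁ g₂ ∧
      e g₁ g₂ = d₁ τ f' g₁ g₂ - u g₁ * f g₂ := by
  obtain ⟨f, rfl⟩ := exists_eq_d₁_of_subsingleton_H2 hs₀ hc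
  have he' : d₂ τ (fun g₁ g₂ => e g₁ g₂ + u g₁ * f g₂) = 0 := by
    ext g₁ g₂ g₃
    have h1 := he g₁ g₂ g₃
    have h2 := congrFun₂ hu g₁ g₂
    simp only [d₁_apply, d₂_apply, hτ, hτ₀, Pi.zero_apply] at h1 h2 ⊢
    linear_combination h1 + f g₃ * h2
  obtain ⟨s, f', h⟩ := exists_eq_smul_add_d₁ hr (d₂_cup_eq_zero hτ hH hu)
    (fun ⟨f, hf⟩ => hcup ⟨f, fun g₁ g₂ => congrFun₂ hf g₁ g₂⟩) he'
  refine ⟨f + s • H, f' - s • (H * u), fun g₁ g₂ => ⟨?_, ?_⟩⟩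
  · simp [d₁_additive_eq_zero hτ₀ hH]
  · have h1 := d₁_mul_eq hτ hH hu g₁ g₂
    have h2 := congrFun₂ h g₁ g₂
    simp only [map_sub, map_smul, Pi.sub_apply, Pi.add_apply, Pi.smul_apply, smul_eq_mul] at h2 ⊢
    linear_combination h2 + s * h1

end NonsplitExtension

end GroupCochain

namespace GroupCochain

section Triangular

variable {k G : Type} [Field k] [Group G] {n : ℕ}

variable (k) in
/-- The matrices vanishing outside the positions selected by `S`. -/
def supportedOn (S : Fin n → Fin n → Prop) : Submodule k (Matrix (Fin n) (Fin n) k) where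
  carrier := {X | ∀ i j, ¬ S i j → X i j = 0}
  add_mem' ha hb i j h := by simp [ha i j h, hb i j h]
  zero_mem' i j _ := rfl
  smul_mem' r a ha i j h := by simp [ha i j h]

theorem supportedOn_mono {S T : Fin n → Fin n → Prop} (hST : ∀ i j, S i j → T i j) :
    supportedOn k S ≤ supportedOn k T :=
  fun _ hX i j hT => hX i j fun hS => hT (hST i j hS)

theorem mem_supportedOn_of_le {S T : Fin n → Fin n → Prop} {X : Matrix (Fin n) (Fin n) k}
    (hX : X ∈ supportedOn k S) (h : ∀ i j, S i j → ¬ T i j → X i j = 0) :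
    X ∈ supportedOn k T := fun i j hT => by
  by_cases hS : S i j
  · exact h i j hS hT
  · exact hX i j hS

/-- A set of positions closed under moving up and to the right. -/
def IsUpRight (S : Fin n → Fin n → Prop) : Prop :=
  ∀ i j i' j', i ≤ i' → j' ≤ j → S i' j' → S i j

/-- The representation `σ` on matrices is triangular with diagonal characters `τ i j`: each entry
of `σ g X` only involves entries of `X` weakly below and to the left. -/
def IsTriangular (σ : Representation k G (Matrix (Fin n) (Fin n) k))
    (τ : Fin n → Fin n → Representation k G k) : Prop :=
  ∀ g X i j, (∀ i' j', i ≤ i' → j' ≤ j → (i', j') ≠ (i, j) → X i' j' = 0) →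
    σ g X i j = τ i j g (X i j)

variable {σ : Representation k G (Matrix (Fin n) (Fin n) k)}
  {τ : Fin n → Fin n → Representation k G k} {S T : Fin n → Fin n → Prop}

theorem IsTriangular.apply_mem (hσ : IsTriangular σ τ) (hS : IsUpRight S) (g : G)
    {X : Matrix (Fin n) (Fin n) k} (hX : X ∈ supportedOn k S) : σ g X ∈ supportedOn k S := by
  intro i j hij
  have h : ∀ i' j', i ≤ i' → j' ≤ j → X i' j' = 0 := fun i' j' hi hj =>
    hX i' j' fun h => hij (hS i j i' j' hi hj h)
  rw [hσ g X i j fun i' j' hi hj _ => h i' j' hi hj, h i j le_rfl le_rfl, map_zero]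

theorem IsTriangular.d₀_mem (hσ : IsTriangular σ τ) (hS : IsUpRight S)
    {X : Matrix (Fin n) (Fin n) k} (hX : X ∈ supportedOn k S) (g : G) :
    d₀ σ X g ∈ supportedOn k S :=
  sub_mem (hσ.apply_mem hS g hX) hX

theorem IsTriangular.d₁_mem (hσ : IsTriangular σ τ) (hS : IsUpRight S)
    {z : G → Matrix (Fin n) (Fin n) k} (hz : ∀ g, z g ∈ supportedOn k S) (g₁ g₂ : G) :
    d₁ σ z g₁ g₂ ∈ supportedOn k S :=
  add_mem (sub_mem (hσ.apply_mem hS g₁ (hz g₂)) (hz _)) (hz _)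

variable {i j : Fin n}

/-- On matrices supported on `S`, the entry `(i, j)` transforms by the character `τ i j`. -/
def EntryEquivariant (σ : Representation k G (Matrix (Fin n) (Fin n) k))
    (τ : Fin n → Fin n → Representation k G k) (S : Fin n → Fin n → Prop) (i j : Fin n) : Prop :=
  ∀ X ∈ supportedOn k S, ∀ g, σ g X i j = τ i j g (X i j)

theorem IsTriangular.entryEquivariant (hσ : IsTriangular σ τ)
    (hij : ∀ i' j', i ≤ i' → j' ≤ j → S i' j' → (i', j') = (i, j)) :
    EntryEquivariant σ τ S i j := fun X hX g =>
  hσ g X i j fun i' j' hi hj hne => hX i' j' fun hS => hne (hij i' j' hi hj hS)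

theorem EntryEquivariant.d₀_apply (h : EntryEquivariant σ τ S i j)
    {X : Matrix (Fin n) (Fin n) k} (hX : X ∈ supportedOn k S) (g : G) :
    d₀ σ X g i j = d₀ (τ i j) (X i j) g := by
  simp [GroupCochain.d₀_apply, h X hX]

theorem EntryEquivariant.d₁_apply (h : EntryEquivariant σ τ S i j)
    {z : G → Matrix (Fin n) (Fin n) k} (hz : ∀ g, z g ∈ supportedOn k S) (g₁ g₂ : G) :
    d₁ σ z g₁ g₂ i j = d₁ (τ i j) (fun g => z g i j) g₁ g₂ := by
  simp [GroupCochain.d₁_apply, h _ (hz _)]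

theorem EntryEquivariant.d₂_apply (h : EntryEquivariant σ τ S i j)
    {c : G → G → Matrix (Fin n) (Fin n) k} (hc : ∀ g₁ g₂, c g₁ g₂ ∈ supportedOn k S)
    (g₁ g₂ g₃ : G) :
    d₂ σ c g₁ g₂ g₃ i j = d₂ (τ i j) (fun g₁ g₂ => c g₁ g₂ i j) g₁ g₂ g₃ := by
  simp [GroupCochain.d₂_apply, h _ (hc _ _)]

theorem mem_of_d₀_mem (hent : ∀ i j, S i j → ¬ T i j → EntryEquivariant σ τ S i j)
    (hinv : ∀ i j, S i j → ¬ T i j → ∀ x, (∀ g, d₀ (τ i j) x g = 0) → x = 0)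
    (X : Matrix (Fin n) (Fin n) k) (hX : X ∈ supportedOn k S)
    (h : ∀ g, d₀ σ X g ∈ supportedOn k T) : X ∈ supportedOn k T :=
  mem_supportedOn_of_le hX fun i j hS hT => hinv i j hS hT _ fun g => by
    rw [← (hent i j hS hT).d₀_apply hX, h g i j hT]

open Classical in
theorem exists_sub_d₁_mem (hσ : IsTriangular σ τ) (hSup : IsUpRight S)
    (hent : ∀ i j, S i j → ¬ T i j → EntryEquivariant σ τ S i j)
    (hH2 : ∀ i j, S i j → ¬ T i j → Subsingleton (groupCohomology.H2 (Rep.of (τ i j))))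
    (c : G → G → Matrix (Fin n) (Fin n) k) (hcS : ∀ g₁ g₂, c g₁ g₂ ∈ supportedOn k S)
    (hc : ∀ g₁ g₂ g₃, d₂ σ c g₁ g₂ g₃ ∈ supportedOn k T) :
    ∃ f : G → Matrix (Fin n) (Fin n) k, (∀ g, f g ∈ supportedOn k S) ∧
      ∀ g₁ g₂, (c - d₁ σ f) g₁ g₂ ∈ supportedOn k T := by
  have key : ∀ i j, ∃ f : G → k, S i j → ¬ T i j →
      (fun g₁ g₂ => c g₁ g₂ i j) = d₁ (τ i j) f := fun i j => by
    by_cases h : S i j ∧ ¬ T i j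
    · obtain ⟨f, hf⟩ := exists_eq_d₁_of_subsingleton_H2 (hH2 i j h.1 h.2)
        (c := fun g₁ g₂ => c g₁ g₂ i j) (by
          ext g₁ g₂ g₃
          rw [← (hent i j h.1 h.2).d₂_apply hcS, hc g₁ g₂ g₃ i j h.2]
          rfl)
      exact ⟨f, fun _ _ => hf⟩
    · exact ⟨0, fun hS hT => absurd ⟨hS, hT⟩ h⟩
  choose f hf using key
  let F : G → Matrix (Fin n) (Fin n) k := fun g => Matrix.of fun i j => if S i j then f i j g else 0
  have hF : ∀ g, F g ∈ supportedOn k S := fun g i j h => if_neg h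
  refine ⟨F, hF, fun g₁ g₂ => ?_⟩
  refine mem_supportedOn_of_le (sub_mem (hcS _ _) (hσ.d₁_mem hSup hF g₁ g₂)) fun i j hS hT => ?_
  change c g₁ g₂ i j - d₁ σ F g₁ g₂ i j = 0
  rw [(hent i j hS hT).d₁_apply hF, show (fun g => F g i j) = f i j from funext fun g => if_pos hS,
    ← hf i j hS hT, sub_self]

open Classical in
theorem exists_sub_d₀_mem (hσ : IsTriangular σ τ) (hSup : IsUpRight S)
    (hent : ∀ i j, S i j → ¬ T i j → EntryEquivariant σ τ S i j)
    (z : G → Matrix (Fin n) (Fin n) k) (hzS : ∀ g, z g ∈ supportedOn k S)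
    (hz : ∀ i j, S i j → ¬ T i j → ∃ a, (fun g => z g i j) = d₀ (τ i j) a) :
    ∃ a ∈ supportedOn k S, ∀ g, (z - d₀ σ a) g ∈ supportedOn k T := by
  have key : ∀ i j, ∃ a : k, S i j → ¬ T i j → (fun g => z g i j) = d₀ (τ i j) a :=
    fun i j => by
      by_cases h : S i j ∧ ¬ T i j
      · obtain ⟨a, ha⟩ := hz i j h.1 h.2
        exact ⟨a, fun _ _ => ha⟩
      · exact ⟨0, fun hS hT => absurd ⟨hS, hT⟩ h⟩
  choose a ha using key
  let A : Matrix (Fin n) (Fin n) k := Matrix.of fun i j => if S i j then a i j else 0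
  have hA : A ∈ supportedOn k S := fun i j h => if_neg h
  refine ⟨A, hA, fun g => ?_⟩
  refine mem_supportedOn_of_le (sub_mem (hzS _) (hσ.d₀_mem hSup hA g)) fun i j hS hT => ?_
  change z g i j - d₀ σ A g i j = 0
  rw [(hent i j hS hT).d₀_apply hA, show A i j = a i j from if_pos hS, ← ha i j hS hT, sub_self]

theorem acyclicPair_of_antichain (hσ : IsTriangular σ τ) (hSup : IsUpRight S)
    (hent : ∀ i j, S i j → ¬ T i j → EntryEquivariant σ τ S i j)
    (hH0 : ∀ i j, S i j → ¬ T i j → ∀ x, (∀ g, d₀ (τ i j) x g = 0) → x = 0)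
    (hH1 : ∀ i j, S i j → ¬ T i j → Subsingleton (groupCohomology.H1 (Rep.of (τ i j))))
    (hH2 : ∀ i j, S i j → ¬ T i j → Subsingleton (groupCohomology.H2 (Rep.of (τ i j)))) :
    AcyclicPair σ (supportedOn k S) (supportedOn k T) where
  zero := mem_of_d₀_mem hent hH0
  one z hzS hz := exists_sub_d₀_mem hσ hSup hent z hzS fun i j hS hT =>
    exists_eq_d₀_of_subsingleton_H1 (hH1 i j hS hT) (by
      ext g₁ g₂
      rw [← (hent i j hS hT).d₁_apply hzS, hz g₁ g₂ i j hT]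
      rfl)
  two := exists_sub_d₁_mem hσ hSup hent hH2

/-- Adjoining a diagonal position `(m, m)` together with its right neighbour `(m, m')`, where the
two characters form a nonsplit extension with nondegenerate cup product. -/
theorem acyclicPair_of_nonsplit {m m' : Fin n} {χ u H : G → k} (hmm : m ≠ m')
    (hσ : IsTriangular σ τ) (hSup : IsUpRight S) (hS : S m m) (hS' : S m m')
    (hT : ¬ T m m) (hT' : ¬ T m m')
    (hST : ∀ i j, S i j → ¬ T i j → i = m ∧ (j = m ∨ j = m'))
    (hent : EntryEquivariant σ τ S m m)
    (hent' : ∀ X ∈ supportedOn k S, ∀ g, σ g X m m' = τ m m' g (X m m') - u g * X m m)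
    (hτ₀ : ∀ g x, τ m m g x = x) (hτ : ∀ g x, τ m m' g x = χ g * x) (hχ : ∃ g, χ g ≠ 1)
    (hr₀ : Module.finrank k (groupCohomology.H1 (Rep.of (τ m m))) = 1)
    (hs₀ : Subsingleton (groupCohomology.H2 (Rep.of (τ m m))))
    (hr₁ : Module.finrank k (groupCohomology.H1 (Rep.of (τ m m'))) = 1)
    (hr₂ : Module.finrank k (groupCohomology.H2 (Rep.of (τ m m'))) = 1)
    (hH : ∀ g₁ g₂, H (g₁ * g₂) = H g₁ + H g₂) (hH0 : ∃ g, H g ≠ 0)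
    (hu : d₁ (τ m m') u = 0) (hu0 : ¬ ∃ a, u = d₀ (τ m m') a)
    (hcup : ¬ ∃ f, ∀ g₁ g₂, H g₁ * (χ g₁ * u g₂) = d₁ (τ m m') f g₁ g₂) :
    AcyclicPair σ (supportedOn k S) (supportedOn k T) := by
  have hd₀ : ∀ X ∈ supportedOn k S, ∀ g,
      d₀ σ X g m m' = d₀ (τ m m') (X m m') g - u g * X m m := fun X hX g => by
    simp only [d₀_apply, Matrix.sub_apply, hent' X hX g]
    ring
  have hd₁ : ∀ z : G → Matrix (Fin n) (Fin n) k, (∀ g, z g ∈ supportedOn k S) → ∀ g₁ g₂,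
      d₁ σ z g₁ g₂ m m' = d₁ (τ m m') (fun g => z g m m') g₁ g₂ - u g₁ * z g₂ m m :=
    fun z hz g₁ g₂ => by
      simp only [d₁_apply, Matrix.sub_apply, Matrix.add_apply, hent' _ (hz _)]
      ring
  have hd₂ : ∀ c : G → G → Matrix (Fin n) (Fin n) k, (∀ g₁ g₂, c g₁ g₂ ∈ supportedOn k S) →
      ∀ g₁ g₂ g₃, d₂ σ c g₁ g₂ g₃ m m' =
        d₂ (τ m m') (fun g₁ g₂ => c g₁ g₂ m m') g₁ g₂ g₃ - u g₁ * c g₂ g₃ m m :=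
    fun c hc g₁ g₂ g₃ => by
      simp only [d₂_apply, Matrix.sub_apply, Matrix.add_apply, hent' _ (hc _ _)]
      ring
  let E : k → k → Matrix (Fin n) (Fin n) k := fun a b => Matrix.single m m a + Matrix.single m m' b
  have hE : ∀ a b, E a b ∈ supportedOn k S := fun a b i j h => by
    have h1 : ¬ (m = i ∧ m = j) := by rintro ⟨rfl, rfl⟩; exact h hS
    have h2 : ¬ (m = i ∧ m' = j) := by rintro ⟨rfl, rfl⟩; exact h hS'
    simp [E, h1, h2]
  have hE₁ : ∀ a b, E a b m m = a := fun a b => by simp [E, hmm.symm]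
  have hE₂ : ∀ a b, E a b m m' = b := fun a b => by simp [E, hmm]
  have hmem : ∀ X ∈ supportedOn k S, X m m = 0 → X m m' = 0 → X ∈ supportedOn k T :=
    fun X hX h1 h2 => mem_supportedOn_of_le hX fun i j hSij hTij => by
      obtain ⟨rfl, rfl | rfl⟩ := hST i j hSij hTij <;> assumption
  refine ⟨fun X hX h => ?_, fun z hzS hz => ?_, fun c hcS hc => ?_⟩
  · obtain ⟨h1, h2⟩ := nonsplit_zero hτ hχ hu0 (x := X m m) (y := X m m') fun g => by
      rw [← hd₀ X hX, h g m m' hT']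
    exact hmem X hX h1 h2
  · obtain ⟨a, b, hab⟩ := nonsplit_one hτ₀ hτ hr₀ hr₁ hH hH0 hu hu0 hcup
      (p := fun g => z g m m) (w := fun g => z g m m')
      (by ext g₁ g₂; rw [← hent.d₁_apply hzS, hz g₁ g₂ m m hT]; rfl)
      (fun g₁ g₂ => by rw [← hd₁ z hzS, hz g₁ g₂ m m' hT'])
    refine ⟨E a b, hE a b, fun g =>
      hmem _ (sub_mem (hzS g) (hσ.d₀_mem hSup (hE a b) g)) ?_ ?_⟩
    · change z g m m - d₀ σ (E a b) g m m = 0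
      rw [hent.d₀_apply (hE a b), hE₁, ← (hab g).1, sub_self]
    · change z g m m' - d₀ σ (E a b) g m m' = 0
      rw [hd₀ _ (hE a b), hE₁, hE₂, ← (hab g).2, sub_self]
  · obtain ⟨f, f', hf⟩ := nonsplit_two hτ₀ hτ hs₀ hr₂ hH hu hcup
      (c := fun g₁ g₂ => c g₁ g₂ m m) (e := fun g₁ g₂ => c g₁ g₂ m m')
      (by ext g₁ g₂ g₃; rw [← hent.d₂_apply hcS, hc g₁ g₂ g₃ m m hT]; rfl)
      (fun g₁ g₂ g₃ => by rw [← hd₂ c hcS, hc g₁ g₂ g₃ m m' hT'])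
    have hF : ∀ g, E (f g) (f' g) ∈ supportedOn k S := fun g => hE _ _
    refine ⟨fun g => E (f g) (f' g), hF, fun g₁ g₂ =>
      hmem _ (sub_mem (hcS g₁ g₂) (hσ.d₁_mem hSup hF g₁ g₂)) ?_ ?_⟩
    · change c g₁ g₂ m m - d₁ σ _ g₁ g₂ m m = 0
      rw [hent.d₁_apply hF, (hf g₁ g₂).1]
      simp only [hE₁, sub_self]
    · change c g₁ g₂ m m' - d₁ σ _ g₁ g₂ m m' = 0
      rw [hd₁ _ hF, (hf g₁ g₂).2]
      simp only [hE₁, hE₂, sub_self]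

end Triangular

end GroupCochain

namespace GroupCochain

section Bands

variable {k G : Type} [Field k] [Group G] {n : ℕ}
  {σ : Representation k G (Matrix (Fin n) (Fin n) k)}
  {τ : Fin n → Fin n → Representation k G k}

/-- The positions on or above the `m`-th diagonal. -/
def band (n : ℕ) (m : ℤ) (i j : Fin n) : Prop := (i : ℤ) + m ≤ j

/-- The positions above the first superdiagonal, and those in the first `m` rows on or above the
diagonal. -/
def rows (n m : ℕ) (i j : Fin n) : Prop := (i : ℤ) + 2 ≤ j ∨ (i ≤ j ∧ (i : ℕ) < m)

theorem isUpRight_band (m : ℤ) : IsUpRight (band n m) := by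
  intro i j i' j' hi hj h
  simp only [band, Fin.le_def] at *
  omega

theorem isUpRight_rows (m : ℕ) : IsUpRight (rows n m) := by
  intro i j i' j' hi hj h
  simp only [rows, Fin.le_def] at *
  omega

theorem supportedOn_band_succ_le (m : ℤ) :
    supportedOn k (band n (m + 1)) ≤ supportedOn k (band n m) :=
  supportedOn_mono fun i j h => by simp only [band] at *; omega

theorem supportedOn_rows_succ_le (m : ℕ) :
    supportedOn k (rows n m) ≤ supportedOn k (rows n (m + 1)) :=
  supportedOn_mono fun i j h => by simp only [rows] at *; omega

theorem eq_of_band_of_not_band_succ {m : ℤ} {i j : Fin n} (h : band n m i j)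
    (h' : ¬ band n (m + 1) i j) : (j : ℤ) = i + m := by
  simp only [band] at *
  omega

theorem IsTriangular.entryEquivariant_band (hσ : IsTriangular σ τ) {m : ℤ} {i j : Fin n}
    (h : (j : ℤ) = i + m) : EntryEquivariant σ τ (band n m) i j :=
  hσ.entryEquivariant fun i' j' hi hj hb => by
    simp only [band, Fin.le_def, Prod.mk.injEq, Fin.ext_iff] at *
    omega

theorem acyclicPair_band_succ (hσ : IsTriangular σ τ)
    (hH0 : ∀ i j, i ≠ j → ∀ x, (∀ g, d₀ (τ i j) x g = 0) → x = 0)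
    (hfar : ∀ i j : Fin n, 2 ≤ |(i : ℤ) - (j : ℤ)| →
      Subsingleton (groupCohomology.H1 (Rep.of (τ i j))) ∧
      Subsingleton (groupCohomology.H2 (Rep.of (τ i j))))
    {m : ℤ} (hm : 2 ≤ |m|) :
    AcyclicPair σ (supportedOn k (band n m)) (supportedOn k (band n (m + 1))) := by
  have habs : ∀ i j : Fin n, band n m i j → ¬ band n (m + 1) i j → 2 ≤ |(i : ℤ) - (j : ℤ)| :=
    fun i j h h' => by
      rw [eq_of_band_of_not_band_succ h h', sub_add_cancel_left, abs_neg]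
      exact hm
  refine acyclicPair_of_antichain hσ (isUpRight_band m)
    (fun i j h h' => hσ.entryEquivariant_band (eq_of_band_of_not_band_succ h h'))
    (fun i j h h' => hH0 i j ?_)
    (fun i j h h' => (hfar i j (habs i j h h')).1) (fun i j h h' => (hfar i j (habs i j h h')).2)
  rintro rfl
  simpa using habs i i h h'

theorem acyclicPair_band_add (a : ℤ) (m : ℕ)
    (h : ∀ l, a ≤ l → l < a + m →
      AcyclicPair σ (supportedOn k (band n l)) (supportedOn k (band n (l + 1)))) :
    AcyclicPair σ (supportedOn k (band n a)) (supportedOn k (band n (a + m))) := by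
  induction m with
  | zero => simpa using AcyclicPair.refl _
  | succ m ih =>
    have h1 := (ih fun l hl hl' => h l hl (by push_cast; omega)).trans
      (h (a + m) (by omega) (by push_cast; omega))
      (supportedOn_mono fun i j h => by simp only [band] at *; omega) (supportedOn_band_succ_le _)
    rwa [Nat.cast_succ, ← add_assoc]

theorem supportedOn_band_eq_bot {m : ℤ} (hm : n ≤ m) : supportedOn k (band n m) = ⊥ := by
  refine (Submodule.eq_bot_iff _).2 fun X hX => ?_
  ext i j
  exact hX i j (by simp only [band]; omega)

theorem supportedOn_band_eq_top {m : ℤ} (hm : m ≤ -n) : supportedOn k (band n m) = ⊤ := by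
  refine (Submodule.eq_top_iff').2 fun X i j h => absurd ?_ h
  simp only [band]
  omega

theorem supportedOn_rows_zero : supportedOn k (rows n 0) = supportedOn k (band n 2) := by
  congr 1
  ext i j
  simp [rows, band]

theorem acyclicPair_top_band (hσ : IsTriangular σ τ)
    (hH0 : ∀ i j, i ≠ j → ∀ x, (∀ g, d₀ (τ i j) x g = 0) → x = 0)
    (hfar : ∀ i j : Fin n, 2 ≤ |(i : ℤ) - (j : ℤ)| →
      Subsingleton (groupCohomology.H1 (Rep.of (τ i j))) ∧
      Subsingleton (groupCohomology.H2 (Rep.of (τ i j)))) :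
    AcyclicPair σ ⊤ (supportedOn k (band n (-1))) := by
  have := acyclicPair_band_add (σ := σ) (-1 - n) n fun l _ hl =>
    acyclicPair_band_succ hσ hH0 hfar (by rw [abs_of_neg] <;> omega)
  rwa [sub_add_cancel, supportedOn_band_eq_top (by omega)] at this

theorem acyclicPair_band_bot (hσ : IsTriangular σ τ)
    (hH0 : ∀ i j, i ≠ j → ∀ x, (∀ g, d₀ (τ i j) x g = 0) → x = 0)
    (hfar : ∀ i j : Fin n, 2 ≤ |(i : ℤ) - (j : ℤ)| →
      Subsingleton (groupCohomology.H1 (Rep.of (τ i j))) ∧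
      Subsingleton (groupCohomology.H2 (Rep.of (τ i j)))) :
    AcyclicPair σ (supportedOn k (band n 2)) ⊥ := by
  have := acyclicPair_band_add (σ := σ) 2 n fun l hl _ =>
    acyclicPair_band_succ hσ hH0 hfar (by rw [abs_of_nonneg] <;> omega)
  rwa [supportedOn_band_eq_bot (m := 2 + n) (by omega)] at this

variable {χ : Fin n → Fin n → G → k} {u : Fin n → G → k} {H : G → k}

theorem acyclicPair_rows (hσ : IsTriangular σ τ)
    (hsup : ∀ i j : Fin n, (i : ℕ) + 1 = j → ∀ X ∈ supportedOn k (rows n j), ∀ g,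
      σ g X i j = τ i j g (X i j) - u i g * X i i)
    (hτ₀ : ∀ i g x, τ i i g x = x) (hτ : ∀ i j g x, τ i j g x = χ i j g * x)
    (hχ : ∀ i j, i ≠ j → ∃ g, χ i j g ≠ 1)
    (hr₀ : ∀ i, Module.finrank k (groupCohomology.H1 (Rep.of (τ i i))) = 1)
    (hs₀ : ∀ i, Subsingleton (groupCohomology.H2 (Rep.of (τ i i))))
    (hr : ∀ i j : Fin n, (i : ℕ) + 1 = j →
      Module.finrank k (groupCohomology.H1 (Rep.of (τ i j))) = 1 ∧
      Module.finrank k (groupCohomology.H2 (Rep.of (τ i j))) = 1)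
    (hH : ∀ g₁ g₂, H (g₁ * g₂) = H g₁ + H g₂) (hH0 : ∃ g, H g ≠ 0)
    (hu : ∀ i j : Fin n, (i : ℕ) + 1 = j → d₁ (τ i j) (u i) = 0 ∧ ¬ ∃ a, u i = d₀ (τ i j) a)
    (hcup : ∀ i j : Fin n, (i : ℕ) + 1 = j →
      ¬ ∃ f, ∀ g₁ g₂, H g₁ * (χ i j g₁ * u i g₂) = d₁ (τ i j) f g₁ g₂)
    (m : ℕ) (hm : m < n) :
    AcyclicPair σ (supportedOn k (rows n m)) (supportedOn k (band n 2)) := by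
  induction m with
  | zero => rw [supportedOn_rows_zero]; exact AcyclicPair.refl _
  | succ m ih =>
    let i : Fin n := ⟨m, by omega⟩
    let j : Fin n := ⟨m + 1, hm⟩
    have hij : (i : ℕ) + 1 = j := rfl
    have hne : i ≠ j := fun h => by simp [i, j] at h
    refine AcyclicPair.trans ?_ (ih (by omega)) (supportedOn_rows_succ_le m)
      (supportedOn_mono fun _ _ h => Or.inl h)
    refine acyclicPair_of_nonsplit (m := i) (m' := j) hne hσ (isUpRight_rows _)
      ?_ ?_ ?_ ?_ ?_ ?_ (hsup i j hij) (hτ₀ i) (hτ i j) (hχ i j hne) (hr₀ i) (hs₀ i)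
      (hr i j hij).1 (hr i j hij).2 hH hH0 (hu i j hij).1 (hu i j hij).2 (hcup i j hij)
    · simp [rows, i]
    · simp [rows, i, j]
    · simp [rows, i]
    · simp [rows, i, j]
    · intro p q h h'
      simp only [rows, i, j, Fin.le_def, Fin.ext_iff] at *
      omega
    · refine hσ.entryEquivariant fun p q hp hq h => ?_
      simp only [rows, i, Fin.le_def, Fin.ext_iff, Prod.mk.injEq] at *
      omega

end Bands

end GroupCochain

namespace GroupCochain

section Main

variable {k G : Type} [Field k] [Group G] {n : ℕ}
  {σ : Representation k G (Matrix (Fin n) (Fin n) k)}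
  {τ : Fin n → Fin n → Representation k G k} {H : G → k} {last : Fin n}

theorem exists_not_coboundary {V : Type} [AddCommGroup V] [Module k V] {ρ : Representation k G V}
    (hr : Module.finrank k (groupCohomology.H1 (Rep.of ρ)) = 1) :
    ∃ v : G → V, d₁ ρ v = 0 ∧ ¬ ∃ a, v = d₀ ρ a := by
  have : Nontrivial (groupCohomology.H1 (Rep.of ρ)) :=
    Module.nontrivial_of_finrank_pos (R := k) (by rw [hr]; exact one_pos)
  obtain ⟨x, hx⟩ := exists_ne (0 : groupCohomology.H1 (Rep.of ρ))
  induction x using groupCohomology.H1_induction_on with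
  | h x => exact ⟨x, (mem_cocycles₁_iff_d₁ _).1 x.2, fun h => hx ((H1π_eq_zero_iff_exists x).2 h)⟩

theorem mem_rows_of_mem_band (hlast : (last : ℕ) + 1 = n) {X : Matrix (Fin n) (Fin n) k}
    (hX : X ∈ supportedOn k (band n 0)) (h : X last last = 0) :
    X ∈ supportedOn k (rows n last) :=
  mem_supportedOn_of_le hX fun i j hb hr => by
    obtain rfl : i = last := by
      simp only [rows, band, Fin.le_def, Fin.ext_iff] at *
      omega
    obtain rfl : j = i := by
      simp only [band, Fin.ext_iff] at *
      omega
    exact h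

theorem supportedOn_rows_last_le (last : Fin n) :
    supportedOn k (rows n last) ≤ supportedOn k (band n 0) :=
  supportedOn_mono fun i j h => by
    simp only [rows, band, Fin.le_def] at *
    omega

theorem mem_band_zero_of_mem_band_neg_one {X : Matrix (Fin n) (Fin n) k}
    (hX : X ∈ supportedOn k (band n (-1)))
    (h : ∀ p q : Fin n, (q : ℕ) + 1 = p → X p q = 0) : X ∈ supportedOn k (band n 0) :=
  mem_supportedOn_of_le hX fun p q hb hb' => h p q (by
    simp only [band] at *
    omega)

theorem exists_eq_d₁_of_mem_band_zero (hσ : IsTriangular σ τ) (hlast : (last : ℕ) + 1 = n)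
    (hs₀ : ∀ i, Subsingleton (groupCohomology.H2 (Rep.of (τ i i))))
    (hT : AcyclicPair σ (supportedOn k (rows n last)) ⊥)
    (c : G → G → Matrix (Fin n) (Fin n) k) (hc : ∀ g₁ g₂, c g₁ g₂ ∈ supportedOn k (band n 0))
    (hc0 : d₂ σ c = 0) :
    ∃ f : G → Matrix (Fin n) (Fin n) k, (∀ g, f g ∈ supportedOn k (band n 0)) ∧ c = d₁ σ f := by
  have hdiag : ∀ i j, band n 0 i j → ¬ rows n last i j → i = last ∧ j = last := fun i j h h' => by
    simp only [rows, band, Fin.le_def, Fin.ext_iff] at *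
    omega
  obtain ⟨f, hf, h⟩ := exists_sub_d₁_mem_trans (supportedOn_rows_last_le last) bot_le
    (exists_sub_d₁_mem (T := rows n last) hσ (isUpRight_band 0)
      (fun i j h h' => by
        obtain ⟨rfl, rfl⟩ := hdiag i j h h'
        exact hσ.entryEquivariant_band (by simp))
      (fun i j h h' => by
        obtain ⟨rfl, rfl⟩ := hdiag i j h h'
        exact hs₀ _))
    hT.two c hc (by simp [hc0])
  exact ⟨f, hf, sub_eq_zero.1 (funext₂ h)⟩

/-- A cocycle on a subdiagonal position lifts to a matrix-valued cocycle. -/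
theorem exists_lift (hσ : IsTriangular σ τ) (hlast : (last : ℕ) + 1 = n)
    (hs₀ : ∀ i, Subsingleton (groupCohomology.H2 (Rep.of (τ i i))))
    (hT : AcyclicPair σ (supportedOn k (rows n last)) ⊥)
    {i j : Fin n} (hij : (i : ℕ) + 1 = j) {v : G → k} (hv : d₁ (τ j i) v = 0) :
    ∃ b : G → Matrix (Fin n) (Fin n) k, d₁ σ b = 0 ∧
      (∀ g, b g ∈ supportedOn k (band n (-1))) ∧
      ∀ p q : Fin n, (q : ℕ) + 1 = p → ∀ g, b g p q = if q = i then v g else 0 := by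
  let z : G → Matrix (Fin n) (Fin n) k := fun g => Matrix.single j i (v g)
  have hz : ∀ g, z g ∈ supportedOn k (band n (-1)) := fun g p q h => by
    refine Matrix.single_apply_of_ne _ _ _ _ _ ?_
    rintro ⟨rfl, rfl⟩
    simp only [band] at h
    omega
  have hzv : ∀ p q : Fin n, (q : ℕ) + 1 = p → ∀ g, z g p q = if q = i then v g else 0 :=
    fun p q hpq g => by
      have : (j = p ∧ i = q) ↔ q = i := by simp only [Fin.ext_iff]; omega
      simp [z, Matrix.single_apply, this]
  obtain ⟨f, hf, h⟩ := exists_eq_d₁_of_mem_band_zero hσ hlast hs₀ hT (d₁ σ z)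
    (fun g₁ g₂ => mem_band_zero_of_mem_band_neg_one (hσ.d₁_mem (isUpRight_band _) hz g₁ g₂)
      fun p q hpq => by
        rw [(hσ.entryEquivariant_band (by omega)).d₁_apply hz, funext (hzv p q hpq)]
        split_ifs with hq
        · obtain rfl : p = j := by simp only [Fin.ext_iff] at *; omega
          subst hq
          exact congrFun₂ hv g₁ g₂
        · exact congrFun₂ (map_zero (d₁ (τ p q))) g₁ g₂)
    (d₂_d₁ z)
  refine ⟨z - f, by rw [map_sub, h, sub_self], fun g => sub_mem (hz g) ?_, fun p q hpq g => ?_⟩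
  · have := supportedOn_band_succ_le (k := k) (n := n) (-1)
    rw [neg_add_cancel] at this
    exact this (hf g)
  · rw [Pi.sub_apply, Matrix.sub_apply, hzv p q hpq, hf g p q (by simp only [band]; omega), sub_zero]

theorem eq_smul_one_of_invariant (hσ : IsTriangular σ τ) (hone : ∀ g, σ g 1 = 1)
    (hH0 : ∀ i j, i ≠ j → ∀ x, (∀ g, d₀ (τ i j) x g = 0) → x = 0)
    (hlast : (last : ℕ) + 1 = n)
    (hA : AcyclicPair σ ⊤ (supportedOn k (band n (-1))))
    (hT : AcyclicPair σ (supportedOn k (rows n last)) ⊥)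
    (X : Matrix (Fin n) (Fin n) k) (hX : ∀ g, σ g X = X) : X = X last last • 1 := by
  have hX0 : ∀ g, d₀ σ X g = 0 := fun g => by rw [d₀_apply, hX, sub_self]
  have h1 := hA.zero X trivial fun g => by rw [hX0]; exact zero_mem _
  have h2 := mem_band_zero_of_mem_band_neg_one h1 fun p q hpq =>
    hH0 p q (by rintro rfl; omega) _ fun g => by
      rw [← (hσ.entryEquivariant_band (by omega)).d₀_apply h1, hX0]; rfl
  have hone' : (1 : Matrix (Fin n) (Fin n) k) ∈ supportedOn k (band n 0) := fun i j h =>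
    Matrix.one_apply_ne (by rintro rfl; simp [band] at h)
  have h3 := mem_rows_of_mem_band hlast (X := X - X last last • 1)
    (sub_mem h2 (Submodule.smul_mem _ _ hone')) (by simp)
  exact sub_eq_zero.1 (hT.zero _ h3 fun g => by simp [d₀_apply, hX, hone])

theorem finrank_H1_of_isTriangular (hσ : IsTriangular σ τ) (hone : ∀ g, σ g 1 = 1)
    (hH0 : ∀ i j, i ≠ j → ∀ x, (∀ g, d₀ (τ i j) x g = 0) → x = 0)
    (hτ₀ : ∀ i g x, τ i i g x = x)
    (hr₀ : ∀ i, Module.finrank k (groupCohomology.H1 (Rep.of (τ i i))) = 1)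
    (hs₀ : ∀ i, Subsingleton (groupCohomology.H2 (Rep.of (τ i i))))
    (hr : ∀ i j : Fin n, (i : ℕ) + 1 = j →
      Module.finrank k (groupCohomology.H1 (Rep.of (τ j i))) = 1)
    (hH : ∀ g₁ g₂, H (g₁ * g₂) = H g₁ + H g₂) (hHne : ∃ g, H g ≠ 0)
    (hlast : (last : ℕ) + 1 = n)
    (hA : AcyclicPair σ ⊤ (supportedOn k (band n (-1))))
    (hT : AcyclicPair σ (supportedOn k (rows n last)) ⊥) :
    Module.finrank k (groupCohomology.H1 (Rep.of σ)) = n := by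
  have hle : supportedOn k (band n 0) ≤ supportedOn k (band n (-1)) := by
    simpa using supportedOn_band_succ_le (k := k) (n := n) (-1)
  have hsub : ∀ p q : Fin n, (q : ℕ) + 1 = p → EntryEquivariant σ τ (band n (-1)) p q :=
    fun p q hpq => hσ.entryEquivariant_band (by omega)
  have hne : ∀ p q : Fin n, (q : ℕ) + 1 = p → p ≠ q := fun p q hpq => by rintro rfl; omega
  have hlast_of : ∀ q : Fin n, (∃ p : Fin n, (q : ℕ) + 1 = p) ∨ q = last := fun q => by
    by_cases hq : (q : ℕ) + 1 < n
    · exact Or.inl ⟨⟨q + 1, hq⟩, rfl⟩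
    · exact Or.inr (Fin.ext (by omega))
  have hlast_not : ∀ p : Fin n, (last : ℕ) + 1 ≠ p := fun p => by omega
  have hv : ∀ q : Fin n, ∃ v : G → k, ∀ p : Fin n, (q : ℕ) + 1 = p →
      d₁ (τ p q) v = 0 ∧ ¬ ∃ a, v = d₀ (τ p q) a := fun q => by
    obtain ⟨p, hp⟩ | rfl := hlast_of q
    · obtain ⟨v, hv⟩ := exists_not_coboundary (hr q p hp)
      refine ⟨v, fun p' hp' => ?_⟩
      obtain rfl : p' = p := Fin.ext (by omega)
      exact hv
    · exact ⟨0, fun p hp => absurd hp (hlast_not p)⟩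
  choose v hv using hv
  let c : G → Matrix (Fin n) (Fin n) k := fun g => H g • 1
  have hc : d₁ σ c = 0 := by
    ext1 g₁; ext1 g₂
    simp only [d₁_apply, c, map_smul, hone, hH, Pi.zero_apply]
    module
  have hcmem : ∀ g, c g ∈ supportedOn k (band n 0) := fun g i j h => by
    have : i ≠ j := by rintro rfl; simp [band] at h
    simp [c, this]
  have hb : ∀ i : Fin n, ∃ b : G → Matrix (Fin n) (Fin n) k, d₁ σ b = 0 ∧
      (∀ g, b g ∈ supportedOn k (band n (-1))) ∧
      (∀ p q : Fin n, (q : ℕ) + 1 = p → ∀ g, b g p q = if q = i then v i g else 0) ∧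
      (i = last → b = c) := fun i => by
    obtain ⟨p, hp⟩ | rfl := hlast_of i
    · obtain ⟨b, h1, h2, h3⟩ := exists_lift hσ hlast hs₀ hT hp (hv i p hp).1
      exact ⟨b, h1, h2, h3, by rintro rfl; exact absurd hp (hlast_not p)⟩
    · refine ⟨c, hc, fun g => hle (hcmem g), fun p q hpq g => ?_, fun _ => rfl⟩
      have : q ≠ i := by rintro rfl; exact hlast_not p hpq
      simp [c, hne p q hpq, this]
  choose b hb1 hb2 hb3 hb4 using hb
  have hsum_mem : ∀ (s : Fin n → k) g, (∑ i, s i • b i) g ∈ supportedOn k (band n (-1)) :=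
    fun s g => by
      rw [Finset.sum_apply]
      exact sum_mem fun i _ => Submodule.smul_mem _ _ (hb2 i g)
  have hsum_apply : ∀ (s : Fin n → k) (p q : Fin n), (q : ℕ) + 1 = p → ∀ g,
      (∑ i, s i • b i) g p q = s q * v q g := fun s p q hpq g => by
    rw [Finset.sum_apply, Matrix.sum_apply]
    simp [hb3 _ p q hpq]
  refine finrank_H1_eq_of_basis b hb1 (fun z hz => ?_) fun s a hs => ?_
  · obtain ⟨a, -, ha⟩ := hA.one z (fun _ => trivial) (by simp [hz])
    have hs : ∀ q : Fin n, ∃ s : k, ∀ p : Fin n, (q : ℕ) + 1 = p →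
        ∃ x, (fun g => (z - d₀ σ a) g p q) = s • v q + d₀ (τ p q) x := fun q => by
      obtain ⟨p, hp⟩ | rfl := hlast_of q
      · obtain ⟨s, x, h⟩ := exists_eq_smul_add_d₀ (hr q p hp) (hv q p hp).1 (hv q p hp).2
          (z := fun g => (z - d₀ σ a) g p q) (by
            ext g₁ g₂
            rw [← (hsub p q hp).d₁_apply ha, map_sub, hz, d₁_d₀]
            simp)
        refine ⟨s, fun p' hp' => ?_⟩
        obtain rfl : p' = p := Fin.ext (by omega)
        exact ⟨x, h⟩
      · exact ⟨0, fun p hp => absurd hp (hlast_not p)⟩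
    choose s hs using hs
    obtain ⟨a', -, ha'⟩ := exists_sub_d₀_mem (T := band n 0) hσ (isUpRight_band (-1))
      (fun p q h h' => hσ.entryEquivariant_band
        (eq_of_band_of_not_band_succ h (by rwa [neg_add_cancel])))
      (z - d₀ σ a - ∑ i, s i • b i) (fun g => sub_mem (ha g) (hsum_mem s g))
      (fun p q h h' => by
        have hpq : (q : ℕ) + 1 = p := by
          have := eq_of_band_of_not_band_succ h (by rwa [neg_add_cancel])
          omega
        obtain ⟨x, hx⟩ := hs q p hpq
        refine ⟨x, funext fun g => ?_⟩
        have := congrFun hx g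
        simp only [Pi.add_apply, Pi.smul_apply, smul_eq_mul] at this
        rw [Pi.sub_apply, Matrix.sub_apply, hsum_apply s p q hpq, this]
        ring)
    have hw : d₁ σ (z - d₀ σ a - ∑ i, s i • b i - d₀ σ a') = 0 := by
      simp [hz, hb1]
    obtain ⟨t, ht⟩ := exists_eq_smul_of_additive (hτ₀ last) (hr₀ last) hH hHne
      (p := fun g => (z - d₀ σ a - ∑ i, s i • b i - d₀ σ a') g last last) (by
        ext g₁ g₂
        rw [← (hσ.entryEquivariant_band (m := 0) (by simp)).d₁_apply ha', hw]
        rfl)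
    obtain ⟨a'', -, ha''⟩ := hT.one (z - d₀ σ a - ∑ i, s i • b i - d₀ σ a' - t • c)
      (fun g => mem_rows_of_mem_band hlast (sub_mem (ha' g) (Submodule.smul_mem _ t (hcmem g))) (by
        have := congrFun ht g
        simp only [Pi.smul_apply, smul_eq_mul] at this
        rw [Pi.sub_apply, Matrix.sub_apply, this]
        simp [c]))
      (by rw [map_sub, hw, map_smul, hc]; simp)
    have hz' := sub_eq_zero.1 (funext ha'' : _ = (0 : G → Matrix (Fin n) (Fin n) k))
    refine ⟨s + Pi.single last t, a + a' + a'', ?_⟩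
    have hsingle : ∑ i, (Pi.single last t : Fin n → k) i • b i = t • c := by
      rw [Finset.sum_eq_single last (fun i _ hi => by simp [hi]) (by simp), Pi.single_eq_same,
        hb4 last rfl]
    simp only [Pi.add_apply, add_smul, Finset.sum_add_distrib, hsingle, map_add, ← hz']
    abel
  · have ha := hA.zero a trivial fun g => by rw [← hs]; exact hsum_mem s g
    have hs_apply : ∀ p q : Fin n, (q : ℕ) + 1 = p → ∀ g,
        s q * v q g = d₀ (τ p q) (a p q) g := fun p q hpq g => by
      rw [← hsum_apply s p q hpq, hs, (hsub p q hpq).d₀_apply ha]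
    have hs0 : ∀ p q : Fin n, (q : ℕ) + 1 = p → s q = 0 := fun p q hpq => by
      by_contra h0
      refine (hv q p hpq).2 ⟨(s q)⁻¹ • a p q, funext fun g => ?_⟩
      rw [map_smul, Pi.smul_apply, ← hs_apply p q hpq, smul_eq_mul, inv_mul_cancel_left₀ h0]
    have ha0 := mem_band_zero_of_mem_band_neg_one ha fun p q hpq =>
      hH0 p q (hne p q hpq) _ fun g => by rw [← hs_apply p q hpq, hs0 p q hpq, zero_mul]
    have hsum : ∑ i, s i • b i = s last • c := by
      rw [Finset.sum_eq_single last (fun i _ hi => ?_) (by simp), hb4 last rfl]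
      obtain ⟨p, hp⟩ | rfl := hlast_of i
      · rw [hs0 p i hp, zero_smul]
      · exact absurd rfl hi
    have hslast : s last = 0 := by
      obtain ⟨g, hg⟩ := hHne
      have h1 : d₀ σ a g last last = 0 := by
        rw [(hσ.entryEquivariant_band (m := 0) (by simp)).d₀_apply ha0, d₀_apply, hτ₀, sub_self]
      rw [← hs, hsum] at h1
      simpa [c, hg] using h1
    ext q
    obtain ⟨p, hp⟩ | rfl := hlast_of q
    · exact hs0 p q hp
    · exact hslast

end Main

end GroupCochain

section UpperTriangular

variable {k : Type} [Field k] {n : ℕ} {P Q X : Matrix (Fin n) (Fin n) k}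

theorem Matrix.mul_apply_of_forall_lt (hP : ∀ i j, j < i → P i j = 0) {i l : Fin n}
    (hX : ∀ i', i < i' → X i' l = 0) : (P * X) i l = P i i * X i l := by
  rw [Matrix.mul_apply]
  refine Finset.sum_eq_single i (fun i' _ hi => ?_) (by simp)
  rcases lt_or_gt_of_ne hi with h | h
  · rw [hP i i' h, zero_mul]
  · rw [hX i' h, mul_zero]

theorem Matrix.mul_mul_apply_of_forall_ne (hP : ∀ i j, j < i → P i j = 0)
    (hQ : ∀ i j, j < i → Q i j = 0) {i j : Fin n}
    (hX : ∀ i' j', i ≤ i' → j' ≤ j → (i', j') ≠ (i, j) → X i' j' = 0) :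
    (P * X * Q) i j = P i i * X i j * Q j j := by
  rw [Matrix.mul_apply, Finset.sum_eq_single j (fun l _ hl => ?_) (by simp),
    mul_apply_of_forall_lt hP fun i' hi => hX i' j hi.le le_rfl (by simp [hi.ne'])]
  rcases lt_or_gt_of_ne hl with h | h
  · rw [mul_apply_of_forall_lt hP fun i' hi => hX i' l hi.le h.le (by simp [hi.ne']),
      hX i l le_rfl h.le (by simp [hl]), mul_zero, zero_mul]
  · rw [hQ l j h, mul_zero]

theorem Matrix.mul_mul_apply_succ (hP : ∀ i j, j < i → P i j = 0)
    (hQ : ∀ i j, j < i → Q i j = 0) {i j : Fin n} (hij : (i : ℕ) + 1 = j)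
    (hX : ∀ i' j', i ≤ i' → j' ≤ j → (i', j') ≠ (i, i) → (i', j') ≠ (i, j) → X i' j' = 0) :
    (P * X * Q) i j = P i i * X i i * Q i j + P i i * X i j * Q j j := by
  have hlt : i < j := by rw [Fin.lt_def]; omega
  rw [Matrix.mul_apply, Finset.sum_eq_add i j hlt.ne (fun l _ hl => ?_) (by simp) (by simp),
    mul_apply_of_forall_lt hP fun i' hi => hX i' i hi.le hlt.le (by simp [hi.ne']) (by simp [hi.ne']),
    mul_apply_of_forall_lt hP fun i' hi => hX i' j hi.le le_rfl (by simp [hi.ne']) (by simp [hi.ne'])]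
  rcases lt_or_gt_of_ne hl.2 with h | h
  · rw [mul_apply_of_forall_lt hP
        fun i' hi => hX i' l hi.le h.le (by simp [hi.ne']) (by simp [hi.ne']),
      hX i l le_rfl h.le (by simp [hl.1]) (by simp [hl.2]), mul_zero, zero_mul]
  · rw [hQ l j h, mul_zero]

theorem Matrix.diagonal_units_zpow (d : Fin n → kˣ) (z : ℤ) :
    (Matrix.diagonal fun i => (d i : k)) ^ z = Matrix.diagonal fun i => (d i : k) ^ z := by
  have hinv : (Matrix.diagonal fun i => (d i : k))⁻¹ = Matrix.diagonal fun i => (d i : k)⁻¹ :=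
    Matrix.inv_eq_left_inv (by simp [Matrix.diagonal_mul_diagonal])
  obtain ⟨m, rfl | rfl⟩ := z.eq_nat_or_neg
  · simp [Matrix.diagonal_pow, Pi.pow_def]
  · have hdet : IsUnit (Matrix.diagonal fun i => (d i : k)).det := by
      rw [Matrix.det_diagonal]
      exact isUnit_iff_ne_zero.2 (Finset.prod_ne_zero_iff.2 fun i _ => (d i).ne_zero)
    rw [Matrix.zpow_neg hdet, zpow_natCast, ← Matrix.inv_pow', hinv, Matrix.diagonal_pow]
    simp [Pi.pow_def]

theorem Matrix.eq_one_of_mul_self_of_unitriangular (hdiag : ∀ i, P i i = 1)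
    (hlow : ∀ i j, j < i → P i j = 0) (hP : P * P = P) : P = 1 := by
  have hdet : IsUnit P.det := by
    rw [Matrix.det_of_isUpperTriangular (fun i j h => hlow i j h)]
    simp [hdiag]
  exact ((Matrix.isUnit_iff_isUnit_det P).2 hdet).mul_left_cancel (by rw [hP, mul_one])

end UpperTriangular

open groupCohomology

/-- The paper's key cohomological computation for the triangular representation
`ρ_D^{(n)}`.  Let `h : Γ → ℤ` be surjective, and for `μ ∈ ℂ*` let `ℂ_μ` be the
`Γ`-module `ℂ` on which `γ` acts by `μ^{h γ}` (here given by the family `rep`).  Let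
`λ_1,…,λ_n ∈ ℂ*` be pairwise distinct with product `1`, and `α_i = λ_i/λ_{i+1}`.  Assume:
(i) `dim H¹(Γ;ℂ) = 1` and `H²(Γ;ℂ) = 0`;
(ii) `H¹(Γ;ℂ_{λ_i/λ_j}) = H²(Γ;ℂ_{λ_i/λ_j}) = 0` for `|i−j| ≥ 2`;
(iii) `dim H¹(Γ;ℂ_{α_i^{±1}}) = dim H²(Γ;ℂ_{α_i^{±1}}) = 1`, and for every non-coboundary
1-cocycle `u` of `ℂ_{α_i^{±1}}` the 2-cocycle `(γ₁,γ₂) ↦ h(γ₁)·α_i^{±h γ₁}·u(γ₂)` is not a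
2-coboundary.
Let `u_i^+` be non-coboundary 1-cocycles of `ℂ_{α_i}` and `ρ(γ) = Z(γ)·D^{h γ}` a
homomorphism with `Z(γ)` upper unitriangular with `(i,i+1)` entry `u_i^+(γ)` and
`D = diag(λ_1,…,λ_n)`.  Consider `M_n(ℂ)` as a `Γ`-module via `γ·X = ρ(γ)·X·ρ(γ)⁻¹`
(the representation `Ad`).  Then `H⁰(Γ;M_n(ℂ))` is one-dimensional, spanned by the
identity matrix, and `H¹(Γ;M_n(ℂ))` is `n`-dimensional. -/
theorem stmt_14 {Γ : Type} [Group Γ]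
    (h : Γ →* Multiplicative ℤ) (hsurj : Function.Surjective h)
    (rep : ℂˣ → Representation ℂ Γ ℂ)
    (hrep : ∀ (μ : ℂˣ) (γ : Γ) (x : ℂ),
      rep μ γ x = (μ : ℂ) ^ (Multiplicative.toAdd (h γ)) * x)
    (n : ℕ) (hn : 2 ≤ n)
    (lam : Fin n → ℂˣ) (hdist : Function.Injective lam)
    (hdet : ∏ i, lam i = 1)
    -- (i) trivial coefficients
    (htriv1 : Module.finrank ℂ (groupCohomology.H1 (Rep.of (rep 1))) = 1)
    (htriv2 : Subsingleton (groupCohomology.H2 (Rep.of (rep 1))))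
    -- (ii) `λ_i/λ_j` with `|i−j| ≥ 2`
    (hfar : ∀ i j : Fin n, 2 ≤ |(i : ℤ) - (j : ℤ)| →
      Subsingleton (groupCohomology.H1 (Rep.of (rep (lam i / lam j)))) ∧
      Subsingleton (groupCohomology.H2 (Rep.of (rep (lam i / lam j)))))
    -- (iii) simple-root conditions for `α_i^{±1}`
    (hnear : ∀ (i : Fin n) (hi : (i : ℕ) + 1 < n) (μ : ℂˣ),
      (μ = lam i / lam ⟨(i : ℕ) + 1, hi⟩ ∨ μ = (lam i / lam ⟨(i : ℕ) + 1, hi⟩)⁻¹) →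
      Module.finrank ℂ (groupCohomology.H1 (Rep.of (rep μ))) = 1 ∧
      Module.finrank ℂ (groupCohomology.H2 (Rep.of (rep μ))) = 1 ∧
      ∀ u : Γ → ℂ,
        (∀ γ₁ γ₂ : Γ, u (γ₁ * γ₂) = u γ₁ + rep μ γ₁ (u γ₂)) →
        (¬ ∃ c : ℂ, ∀ γ : Γ, u γ = rep μ γ c - c) →
        ¬ ∃ f : Γ → ℂ, ∀ γ₁ γ₂ : Γ,
          ((Multiplicative.toAdd (h γ₁) : ℤ) : ℂ) *
              ((μ : ℂ) ^ (Multiplicative.toAdd (h γ₁))) * u γ₂ =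
            rep μ γ₁ (f γ₂) - f (γ₁ * γ₂) + f γ₁)
    -- the non-coboundary cocycles `u_i^+`
    (uplus : Fin n → Γ → ℂ)
    (hucoc : ∀ (i : Fin n) (hi : (i : ℕ) + 1 < n), ∀ γ₁ γ₂ : Γ,
      uplus i (γ₁ * γ₂) =
        uplus i γ₁ + rep (lam i / lam ⟨(i : ℕ) + 1, hi⟩) γ₁ (uplus i γ₂))
    (hunp : ∀ (i : Fin n) (hi : (i : ℕ) + 1 < n),
      ¬ ∃ c : ℂ, ∀ γ : Γ, uplus i γ = rep (lam i / lam ⟨(i : ℕ) + 1, hi⟩) γ c - c)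
    -- the triangular representation `ρ(γ) = Z(γ)·D^{h γ}`
    (Z : Γ → Matrix (Fin n) (Fin n) ℂ)
    (hZdiag : ∀ (γ : Γ) (i : Fin n), Z γ i i = 1)
    (hZlow : ∀ (γ : Γ) (i j : Fin n), j < i → Z γ i j = 0)
    (hZsup : ∀ (γ : Γ) (i : Fin n) (hi : (i : ℕ) + 1 < n),
      Z γ i ⟨(i : ℕ) + 1, hi⟩ = uplus i γ)
    (ρ : Γ → Matrix (Fin n) (Fin n) ℂ)
    (hρform : ∀ γ : Γ,
      ρ γ = Z γ * (Matrix.diagonal fun i => (lam i : ℂ)) ^ (Multiplicative.toAdd (h γ)))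
    (hρmul : ∀ γ₁ γ₂ : Γ, ρ (γ₁ * γ₂) = ρ γ₁ * ρ γ₂)
    -- the adjoint action on `M_n(ℂ)`
    (Ad : Representation ℂ Γ (Matrix (Fin n) (Fin n) ℂ))
    (hAd : ∀ (γ : Γ) (X : Matrix (Fin n) (Fin n) ℂ), Ad γ X = ρ γ * X * (ρ γ)⁻¹) :
    Ad.invariants = Submodule.span ℂ {(1 : Matrix (Fin n) (Fin n) ℂ)} ∧
    Module.finrank ℂ Ad.invariants = 1 ∧
    Module.finrank ℂ (groupCohomology.H1 (Rep.of Ad)) = n := by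
  have hentry : ∀ γ i j, ρ γ i j = Z γ i j * (lam j : ℂ) ^ Multiplicative.toAdd (h γ) :=
    fun γ i j => by rw [hρform, Matrix.diagonal_units_zpow, Matrix.mul_diagonal]
  have hlow : ∀ γ i j, j < i → ρ γ i j = 0 := fun γ i j hij => by
    rw [hentry, hZlow γ i j hij, zero_mul]
  have hdiag : ∀ γ i, ρ γ i i = (lam i : ℂ) ^ Multiplicative.toAdd (h γ) := fun γ i => by
    rw [hentry, hZdiag, one_mul]
  have hρone : ρ 1 = 1 :=
    Matrix.eq_one_of_mul_self_of_unitriangular (fun i => by simp [hdiag]) (hlow 1)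
      (by rw [← hρmul, mul_one])
  have hρinv : ∀ γ, ρ γ * ρ γ⁻¹ = 1 := fun γ => by rw [← hρmul, mul_inv_cancel, hρone]
  replace hAd : ∀ γ X, Ad γ X = ρ γ * X * ρ γ⁻¹ := fun γ X => by
    rw [hAd, Matrix.inv_eq_right_inv (hρinv γ)]
  have hAdone : ∀ γ, Ad γ 1 = 1 := fun γ => by rw [hAd, mul_one, hρinv]
  let τ : Fin n → Fin n → Representation ℂ Γ ℂ := fun i j => rep (lam i / lam j)
  let χ : Fin n → Fin n → Γ → ℂ := fun i j γ =>
    ((lam i / lam j : ℂˣ) : ℂ) ^ Multiplicative.toAdd (h γ)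
  let H : Γ → ℂ := fun γ => ((Multiplicative.toAdd (h γ) : ℤ) : ℂ)
  have hτ : ∀ i j γ x, τ i j γ x = χ i j γ * x := fun i j => hrep _
  have hdiag_mul : ∀ i j γ, ρ γ i i * ρ γ⁻¹ j j = χ i j γ := fun i j γ => by
    simp only [hdiag, χ, map_inv, toAdd_inv, zpow_neg, Units.val_div_eq_div_val,
      div_zpow]
    exact (div_eq_mul_inv _ _).symm
  have hσ : GroupCochain.IsTriangular Ad τ := fun γ X i j hX => by
    rw [hAd, Matrix.mul_mul_apply_of_forall_ne (hlow _) (hlow _) hX, hτ, ← hdiag_mul]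
    ring
  have hτ_self : ∀ i, τ i i = rep 1 := fun i => by simp only [τ, div_self']
  have hτ₀ : ∀ i γ x, τ i i γ x = x := fun i γ x => by simp [hτ_self, hrep]
  have hr₀ : ∀ i, Module.finrank ℂ (H1 (Rep.of (τ i i))) = 1 := fun i => by rwa [hτ_self]
  have hs₀ : ∀ i, Subsingleton (H2 (Rep.of (τ i i))) := fun i => by rwa [hτ_self]
  have hH : ∀ γ₁ γ₂, H (γ₁ * γ₂) = H γ₁ + H γ₂ := fun γ₁ γ₂ => by simp [H]
  obtain ⟨γ₀, hγ₀⟩ := hsurj (Multiplicative.ofAdd 1)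
  have hHne : ∃ γ, H γ ≠ 0 := ⟨γ₀, by simp [H, hγ₀]⟩
  have hχ : ∀ i j, i ≠ j → ∃ γ, χ i j γ ≠ 1 := fun i j hij => ⟨γ₀, by
    simp only [χ, hγ₀, toAdd_ofAdd, zpow_one, ne_eq, Units.val_eq_one, div_eq_one]
    exact fun he => hij (hdist he)⟩
  have hH0 : ∀ i j, i ≠ j → ∀ x, (∀ γ, GroupCochain.d₀ (τ i j) x γ = 0) → x = 0 :=
    fun i j hij x => GroupCochain.eq_zero_of_d₀_eq_zero (hτ i j) (hχ i j hij)
  have hcocycle : ∀ i j : Fin n, (i : ℕ) + 1 = j → ∀ γ₁ γ₂,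
      uplus i (γ₁ * γ₂) = uplus i γ₁ + τ i j γ₁ (uplus i γ₂) := by
    rintro i ⟨_, hi⟩ rfl
    exact hucoc i hi
  have hnonzero : ∀ i j : Fin n, (i : ℕ) + 1 = j →
      ¬ ∃ c : ℂ, ∀ γ, uplus i γ = τ i j γ c - c := by
    rintro i ⟨_, hi⟩ rfl
    exact hunp i hi
  have hsup : ∀ i j : Fin n, (i : ℕ) + 1 = j → ∀ X ∈ GroupCochain.supportedOn ℂ
      (GroupCochain.rows n j), ∀ γ, Ad γ X i j = τ i j γ (X i j) - uplus i γ * X i i := by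
    intro i j hij X hX γ
    have hQ : ρ γ⁻¹ i j = uplus i γ⁻¹ * ρ γ⁻¹ j j := by
      obtain ⟨_, hj⟩ := j
      subst hij
      rw [hentry, hZsup _ _ hj, hdiag]
    have hone : uplus i 1 = 0 := by simpa [hτ, χ] using hcocycle i j hij 1 1
    have hinv := hcocycle i j hij γ γ⁻¹
    rw [mul_inv_cancel, hone, hτ] at hinv
    rw [hAd, Matrix.mul_mul_apply_succ (hlow _) (hlow _) hij, hQ, hτ]
    · linear_combination (uplus i γ⁻¹ * X i i + X i j) * hdiag_mul i j γ - X i i * hinv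
    · intro i' j' hi hj h1 h2
      refine hX i' j' fun hr => ?_
      simp only [GroupCochain.rows, Fin.le_def, ne_eq, Prod.mk.injEq, Fin.ext_iff] at *
      omega
  have hroot : ∀ i j : Fin n, (i : ℕ) + 1 = j →
      Module.finrank ℂ (H1 (Rep.of (τ i j))) = 1 ∧ Module.finrank ℂ (H2 (Rep.of (τ i j))) = 1 ∧
      Module.finrank ℂ (H1 (Rep.of (τ j i))) = 1 ∧
      ¬ ∃ f, ∀ γ₁ γ₂, H γ₁ * (χ i j γ₁ * uplus i γ₂) = GroupCochain.d₁ (τ i j) f γ₁ γ₂ := by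
    intro i j hij
    have hc := hcocycle i j hij
    have hn := hnonzero i j hij
    obtain ⟨_, hj⟩ := j
    subst hij
    obtain ⟨h1, h2, h3⟩ := hnear i hj _ (Or.inl rfl)
    refine ⟨h1, h2, (hnear i hj _ (Or.inr (inv_div _ _).symm)).1, ?_⟩
    rintro ⟨f, hf⟩
    exact h3 _ hc hn ⟨f, fun γ₁ γ₂ => (mul_assoc _ _ _).trans (hf γ₁ γ₂)⟩
  have hu : ∀ i j : Fin n, (i : ℕ) + 1 = j → GroupCochain.d₁ (τ i j) (uplus i) = 0 ∧
      ¬ ∃ a, uplus i = GroupCochain.d₀ (τ i j) a := fun i j hij => by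
    refine ⟨?_, fun ⟨a, ha⟩ => hnonzero i j hij ⟨a, congrFun ha⟩⟩
    ext γ₁ γ₂
    rw [GroupCochain.d₁_apply, hcocycle i j hij, Pi.zero_apply, Pi.zero_apply]
    ring
  let last : Fin n := ⟨n - 1, by omega⟩
  have hlast : (last : ℕ) + 1 = n := Nat.sub_add_cancel (by omega)
  have hA := GroupCochain.acyclicPair_top_band hσ hH0 hfar
  have hT := (GroupCochain.acyclicPair_rows hσ hsup hτ₀ hτ hχ hr₀ hs₀
    (fun i j hij => ⟨(hroot i j hij).1, (hroot i j hij).2.1⟩) hH hHne hu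
    (fun i j hij => (hroot i j hij).2.2.2) last last.2).trans
      (GroupCochain.acyclicPair_band_bot hσ hH0 hfar)
      (GroupCochain.supportedOn_mono fun _ _ hb => Or.inl hb) bot_le
  have hinvariants : Ad.invariants = Submodule.span ℂ {(1 : Matrix (Fin n) (Fin n) ℂ)} := by
    refine le_antisymm (fun X hX => Submodule.mem_span_singleton.2 ⟨X last last, ?_⟩) ?_
    · exact (GroupCochain.eq_smul_one_of_invariant hσ hAdone hH0 hlast hA hT X hX).symm
    · rw [Submodule.span_singleton_le_iff_mem]
      exact hAdone
  have : Nonempty (Fin n) := ⟨last⟩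
  refine ⟨hinvariants, by rw [hinvariants, finrank_span_singleton one_ne_zero], ?_⟩
  exact GroupCochain.finrank_H1_of_isTriangular hσ hAdone hH0 hτ₀ hr₀ hs₀
    (fun i j hij => (hroot i j hij).2.2.1) hH hHne hlast hA hT
end
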